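/- arXiv:1803.11500 — 2 statements merged into one kernel-verified Lean document; each statement's English description precedes it below -/
import Mathlib

section
/- If a multi-sequence y = (y_α)_{α∈ℕⁿ} of real numbers satisfies M_d(y) ⪰ 0 for every d (all moment matrices are positive semidefinite) and the Carleman-type condition ∑_{k=1}^∞ L_y(x_i^{2k})^{-1/(2k)} = +∞ for each i = 1,…,n, then y has a representing Borel measure μ on ℝⁿ, and moreover μ is the unique measure with these moments (μ is moment determinate). -/
open MeasureTheory MvPolynomial

/-- The Riesz functional associated with a multi-sequence `y = (y_α)_{α ∈ ℕⁿ}`. -/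
noncomputable def rieszFunctional {n : ℕ} (y : (Fin n → ℕ) → ℝ)
    (p : MvPolynomial (Fin n) ℝ) : ℝ :=
  ∑ α ∈ p.support, p.coeff α * y α

/-- A measure `μ` on `ℝⁿ` represents the multi-sequence `y` if every monomial is
integrable and its integral equals the corresponding entry of `y`. -/
def RepresentsSeq {n : ℕ} (μ : Measure (Fin n → ℝ)) (y : (Fin n → ℕ) → ℝ) : Prop :=
  (∀ α : Fin n → ℕ, Integrable (fun x : Fin n → ℝ => ∏ i, x i ^ α i) μ) ∧
  (∀ α : Fin n → ℕ, (∫ x, (∏ i, x i ^ α i) ∂μ) = y α)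

open scoped InnerProductSpace ComplexConjugate

/-- **Carleman's inequality**, in its qualitative form. -/
theorem summable_geomMean_of_summable {a : ℕ → ℝ} (ha : ∀ k, 0 ≤ a k) (hs : Summable a) :
    Summable fun n : ℕ => (∏ k ∈ Finset.range (n + 1), a k) ^ ((1 : ℝ) / (n + 1)) := by
  set c : ℕ → ℝ := fun k => (k + 2 : ℝ) ^ (k + 1) / (k + 1 : ℝ) ^ k with hc
  have hc0 : ∀ k, 0 ≤ c k := fun k => by positivity
  have hprod : ∀ n : ℕ, ∏ k ∈ Finset.range n, c k = (n + 1 : ℝ) ^ n := by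
    intro n
    induction n with
    | zero => simp
    | succ n ih =>
      rw [Finset.prod_range_succ, ih]
      simp only [hc]
      push_cast
      field_simp
      ring
  have hgeom : ∀ n : ℕ, (∏ k ∈ Finset.range (n + 1), a k) ^ ((1 : ℝ) / (n + 1)) ≤
      (∑ k ∈ Finset.range (n + 1), a k * c k) / ((n + 1) * (n + 2)) := by
    intro n
    have h1 := Real.geom_mean_le_arith_mean_weighted (Finset.range (n + 1))
      (fun _ => (1 : ℝ) / (n + 1)) (fun k => a k * c k) (fun _ _ => by positivity)
      (by simp; field_simp) (fun k _ => mul_nonneg (ha k) (hc0 k))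
    rw [Real.finsetProd_rpow _ _ (fun k _ => mul_nonneg (ha k) (hc0 k)),
      Finset.prod_mul_distrib, hprod, Real.mul_rpow (Finset.prod_nonneg fun k _ => ha k)
      (by positivity), ← Finset.mul_sum] at h1
    have h2 : (((n + 1 : ℕ) : ℝ) + 1) ^ (n + 1) = ((n + 2 : ℝ)) ^ ((n + 1 : ℕ) : ℝ) := by
      rw [Real.rpow_natCast]
      push_cast
      ring
    rw [h2, ← Real.rpow_mul (by positivity)] at h1
    have h3 : ((n + 1 : ℕ) : ℝ) * (1 / (n + 1)) = 1 := by push_cast; field_simp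
    rw [h3, Real.rpow_one] at h1
    rw [le_div_iff₀ (by positivity)]
    calc _ = (n + 1) * ((∏ k ∈ Finset.range (n + 1), a k) ^ ((1 : ℝ) / (n + 1)) * (n + 2)) := by
          ring
      _ ≤ (n + 1) * (1 / (n + 1) * ∑ k ∈ Finset.range (n + 1), a k * c k) := by gcongr
      _ = _ := by field_simp
  have hbound : ∀ N : ℕ, ∑ n ∈ Finset.range N, (∏ k ∈ Finset.range (n + 1), a k) ^
      ((1 : ℝ) / (n + 1)) ≤ ∑ k ∈ Finset.range N, a k * c k * (1 / (k + 1) - 1 / (N + 1)) := by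
    intro N
    induction N with
    | zero => simp
    | succ N ih =>
      rw [Finset.sum_range_succ]
      refine (add_le_add ih (hgeom N)).trans (le_of_eq ?_)
      rw [Finset.sum_range_succ _ N, Finset.sum_range_succ _ N, add_div, ← add_assoc,
        Finset.sum_div, ← Finset.sum_add_distrib]
      congr 1
      · refine Finset.sum_congr rfl fun k _ => ?_
        push_cast
        field_simp
        ring
      · push_cast
        field_simp
        ring
  have hce : ∀ k : ℕ, c k / (k + 1) ≤ Real.exp 1 := by
    intro k
    have h1 : c k / (k + 1) = (1 / ((k : ℝ) + 1) + 1) ^ (k + 1) := by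
      simp only [hc]
      rw [div_div, ← pow_succ, ← div_pow]
      congr 1
      field_simp
      ring
    rw [h1]
    calc _ ≤ (Real.exp (1 / ((k : ℝ) + 1))) ^ (k + 1) := by
          gcongr
          exact Real.add_one_le_exp _
      _ = _ := by
          rw [← Real.exp_nat_mul]
          congr 1
          push_cast
          field_simp
  refine summable_of_sum_range_le (c := Real.exp 1 * ∑' k, a k)
    (fun n => Real.rpow_nonneg (Finset.prod_nonneg fun k _ => ha k) _) fun N => ?_
  refine (hbound N).trans ?_
  calc _ ≤ ∑ k ∈ Finset.range N, Real.exp 1 * a k := by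
        refine Finset.sum_le_sum fun k _ => ?_
        have : a k * c k * (1 / ((k : ℝ) + 1) - 1 / ((N : ℝ) + 1)) ≤ a k * (c k / (k + 1)) := by
          have h0 : 0 ≤ a k * c k * (1 / ((N : ℝ) + 1)) :=
            mul_nonneg (mul_nonneg (ha k) (hc0 k)) (by positivity)
          have h1 : a k * (c k / (k + 1)) = a k * c k * (1 / ((k : ℝ) + 1)) := by ring
          rw [h1, mul_sub]
          linarith
        refine this.trans ?_
        rw [mul_comm]
        gcongr
        · exact ha k
        · exact hce k
    _ = Real.exp 1 * ∑ k ∈ Finset.range N, a k := by rw [Finset.mul_sum]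
    _ ≤ _ := by
        gcongr
        exact hs.sum_le_tsum _ fun k _ => ha k

/-- Solution of the three-term recurrence of a Jacobi operator at the point `Complex.I`. -/
noncomputable def jacobiSol (a h : ℕ → ℝ) : ℕ → ℂ
  | 0 => 1
  | 1 => Complex.I - a 0
  | n + 2 => (Complex.I - a (n + 1)) * jacobiSol a h (n + 1) -
      ((h (n + 1) / h n : ℝ) : ℂ) * jacobiSol a h n

theorem jacobiSol_wronskian (a h : ℕ → ℝ) (n : ℕ) (hh : ∀ k ≤ n, 0 < h k) :
    (jacobiSol a h (n + 1) * conj (jacobiSol a h n)).im / h n =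
      ∑ k ∈ Finset.range (n + 1), ‖jacobiSol a h k‖ ^ 2 / h k := by
  induction n with
  | zero => simp [jacobiSol]
  | succ n ih =>
    have h0 := hh n (by omega)
    have h1 := hh (n + 1) le_rfl
    rw [Finset.sum_range_succ, ← ih fun k hk => hh k (by omega)]
    simp only [← Complex.normSq_eq_norm_sq, Complex.normSq_apply]
    rw [jacobiSol]
    simp only [Complex.mul_im, Complex.sub_im, Complex.sub_re, Complex.mul_re, Complex.I_re,
      Complex.I_im, Complex.ofReal_re, Complex.ofReal_im, Complex.conj_re, Complex.conj_im]
    field_simp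
    ring

theorem jacobiSol_ne_zero (a h : ℕ → ℝ) (n : ℕ) (hh : ∀ k < n, 0 < h k) :
    jacobiSol a h n ≠ 0 := by
  cases n with
  | zero => simp [jacobiSol]
  | succ n =>
    intro h0
    have h1 := jacobiSol_wronskian a h n fun k hk => hh k (by omega)
    rw [h0, zero_mul, Complex.zero_im, zero_div, Finset.sum_range_succ'] at h1
    have h2 : 0 ≤ ∑ k ∈ Finset.range n, ‖jacobiSol a h (k + 1)‖ ^ 2 / h (k + 1) :=
      Finset.sum_nonneg fun k hk =>
        div_nonneg (by positivity) (hh _ (by simp at hk; omega)).le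
    have h3 : 0 < ‖jacobiSol a h 0‖ ^ 2 / h 0 :=
      div_pos (by simp [jacobiSol]) (hh 0 (by omega))
    linarith

/-- If the sums `∑ |π_k|² / h_k` stay bounded then the inverse off-diagonal entries of the
Jacobi operator are summable. -/
theorem summable_of_jacobiSol_bounded (a h : ℕ → ℝ) (hh : ∀ k, 0 < h k) (C : ℝ)
    (hC : ∀ n, ∑ k ∈ Finset.range n, ‖jacobiSol a h k‖ ^ 2 / h k ≤ C) :
    Summable fun n => √(h n / h (n + 1)) := by
  set u : ℕ → ℝ := fun k => ‖jacobiSol a h k‖ ^ 2 / h k with hu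
  have hu0 : ∀ k, 0 ≤ u k := fun k => div_nonneg (by positivity) (hh k).le
  have hus : Summable u := summable_of_sum_range_le hu0 hC
  have hsum : Summable fun n => h 0 * (u n + u (n + 1)) :=
    (hus.add ((summable_nat_add_iff 1).2 hus)).mul_left _
  refine Summable.of_nonneg_of_le (fun n => Real.sqrt_nonneg _) (fun n => ?_) hsum
  have h1 := jacobiSol_wronskian a h n fun k _ => hh k
  have h2 : 1 / h 0 ≤ ∑ k ∈ Finset.range (n + 1), u k := by
    have := Finset.single_le_sum (f := u) (fun k _ => hu0 k)
      (Finset.mem_range.2 (Nat.succ_pos n))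
    simpa [hu, jacobiSol] using this
  have h3 : 1 / h 0 ≤ ‖jacobiSol a h (n + 1)‖ * ‖jacobiSol a h n‖ / h n := by
    refine (h2.trans h1.symm.le).trans ?_
    have := hh n
    gcongr
    refine (Complex.abs_im_le_norm _ |> (le_abs_self _).trans).trans ?_
    simp
  have hn := hh n
  have hn1 := hh (n + 1)
  have h00 := hh 0
  have h4 : √(h n / h (n + 1)) ≤ h 0 * (√(u n) * √(u (n + 1))) := by
    have e1 : √(u n) = ‖jacobiSol a h n‖ / √(h n) := by
      rw [hu]; simp only; rw [Real.sqrt_div' _ hn.le, Real.sqrt_sq (norm_nonneg _)]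
    have e2 : √(u (n + 1)) = ‖jacobiSol a h (n + 1)‖ / √(h (n + 1)) := by
      rw [hu]; simp only; rw [Real.sqrt_div' _ hn1.le, Real.sqrt_sq (norm_nonneg _)]
    rw [e1, e2, Real.sqrt_div hn.le]
    have s1 := Real.sqrt_pos.2 hn
    have s2 := Real.sqrt_pos.2 hn1
    rw [div_le_div_iff₀ h00 hn, one_mul, ← Real.mul_self_sqrt hn.le] at h3
    rw [div_le_iff₀ s2]
    have e3 : h 0 * (‖jacobiSol a h n‖ / √(h n) * (‖jacobiSol a h (n + 1)‖ / √(h (n + 1)))) *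
        √(h (n + 1)) = (‖jacobiSol a h (n + 1)‖ * ‖jacobiSol a h n‖ * h 0) / √(h n) := by
      field_simp
    rw [e3, le_div_iff₀ s1]
    exact h3
  refine h4.trans ?_
  gcongr
  nlinarith [Real.sq_sqrt (hu0 n), Real.sq_sqrt (hu0 (n + 1)), sq_nonneg (√(u n) - √(u (n + 1))),
    hu0 n, hu0 (n + 1)]

section Lanczos

variable {E : Type*} [SeminormedAddCommGroup E] [InnerProductSpace ℂ E]

/-- The diagonal Jacobi coefficient of a vector. -/
noncomputable def rayleighCoeff (M : E →ₗ[ℂ] E) (v : E) : ℝ :=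
  (⟪v, M v⟫_ℂ).re / ‖v‖ ^ 2

/-- The (monic, unnormalised) Lanczos vectors of `M` started at `f`. -/
noncomputable def lanczos (M : E →ₗ[ℂ] E) (f : E) : ℕ → E
  | 0 => f
  | 1 => M f - ((rayleighCoeff M f : ℝ) : ℂ) • f
  | n + 2 => M (lanczos M f (n + 1)) -
      ((rayleighCoeff M (lanczos M f (n + 1)) : ℝ) : ℂ) • lanczos M f (n + 1) -
      ((‖lanczos M f (n + 1)‖ ^ 2 / ‖lanczos M f n‖ ^ 2 : ℝ) : ℂ) • lanczos M f n

variable {M : E →ₗ[ℂ] E} {f : E}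

/-- The Jacobi solution attached to the Lanczos process. -/
noncomputable def lanczosSol (M : E →ₗ[ℂ] E) (f : E) : ℕ → ℂ :=
  jacobiSol (fun n => rayleighCoeff M (lanczos M f n)) (fun n => ‖lanczos M f n‖ ^ 2)

theorem lanczos_mem {W : Submodule ℂ E} (hW : ∀ w ∈ W, M w ∈ W) (hf : f ∈ W) (n : ℕ) :
    lanczos M f n ∈ W := by
  induction n using Nat.twoStepInduction with
  | zero => exact hf
  | one => exact W.sub_mem (hW _ hf) (W.smul_mem _ hf)
  | more n h0 h1 =>
    exact W.sub_mem (W.sub_mem (hW _ h1) (W.smul_mem _ h1)) (W.smul_mem _ h0)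

theorem lanczos_sub_mem {W : Submodule ℂ E} (hW : ∀ w ∈ W, M w ∈ W) (hf : f ∈ W) (n : ℕ) :
    lanczos M f n - lanczosSol M f n • f ∈ W.map (M - Complex.I • LinearMap.id) := by
  have key : ∀ w ∈ W, M w - Complex.I • w ∈ W.map (M - Complex.I • LinearMap.id) :=
    fun w hw => ⟨w, hw, by simp⟩
  induction n using Nat.twoStepInduction with
  | zero => simp [lanczos, lanczosSol, jacobiSol]
  | one =>
    convert key f hf using 1
    simp only [lanczos, lanczosSol, jacobiSol]
    module
  | more n h0 h1 =>
    have h2 := key _ (lanczos_mem hW hf (n + 1))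
    convert Submodule.sub_mem _ (Submodule.add_mem _ h2 (Submodule.smul_mem _
      (Complex.I - rayleighCoeff M (lanczos M f (n + 1)) : ℂ) h1)) (Submodule.smul_mem _
      ((‖lanczos M f (n + 1)‖ ^ 2 / ‖lanczos M f n‖ ^ 2 : ℝ) : ℂ) h0) using 1
    simp only [lanczosSol]
    rw [lanczos, jacobiSol]
    module

theorem inner_self_apply_eq (hM : M.IsSymmetric) (v : E) (hv : ‖v‖ ≠ 0) :
    ⟪v, M v⟫_ℂ = (rayleighCoeff M v : ℝ) * ((‖v‖ ^ 2 : ℝ) : ℂ) := by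
  rw [← Complex.ofReal_mul, rayleighCoeff, div_mul_cancel₀ _ (by positivity)]
  apply Complex.ext
  · simp
  · rw [Complex.ofReal_im, ← Complex.conj_eq_iff_im, inner_conj_symm, hM]

theorem inner_map_lanczos {k : ℕ} {w : E} (h : ∀ j ≤ k, ⟪lanczos M f j, w⟫_ℂ = 0) :
    ⟪M (lanczos M f k), w⟫_ℂ = ⟪lanczos M f (k + 1), w⟫_ℂ := by
  cases k with
  | zero =>
    have := h 0 le_rfl
    simp only [lanczos] at this ⊢
    rw [inner_sub_left, inner_smul_left, this, mul_zero, sub_zero]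
  | succ k =>
    have h0 := h k (by omega)
    have h1 := h (k + 1) le_rfl
    rw [lanczos]
    rw [inner_sub_left, inner_sub_left, inner_smul_left, inner_smul_left, h0, h1]
    simp only [mul_zero, sub_zero]

theorem inner_lanczos_of_lt (hM : M.IsSymmetric) (hv : ∀ n, ‖lanczos M f n‖ ≠ 0) (n : ℕ) :
    ∀ k < n, ⟪lanczos M f k, lanczos M f n⟫_ℂ = 0 := by
  induction n using Nat.strong_induction_on with
  | _ n ih =>
  intro k hk
  have hself : ∀ m, ⟪lanczos M f m, lanczos M f m⟫_ℂ = ((‖lanczos M f m‖ ^ 2 : ℝ) : ℂ) :=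
    fun m => by rw [inner_self_eq_norm_sq_to_K]; push_cast; rfl
  match n, ih with
  | 0, _ => omega
  | 1, _ =>
    obtain rfl : k = 0 := by omega
    have h1 := inner_self_apply_eq hM _ (hv 0)
    have h2 := hself 0
    simp only [lanczos] at h1 h2 ⊢
    rw [inner_sub_right, inner_smul_right, h1, h2, sub_self]
  | n + 2, ih =>
    have hn := hv n
    rw [lanczos, inner_sub_right, inner_sub_right, inner_smul_right, inner_smul_right]
    rcases (by omega : k = n + 1 ∨ k = n ∨ k < n) with rfl | rfl | hkn
    · rw [inner_self_apply_eq hM _ (hv _), hself, inner_eq_zero_symm.1 (ih (n + 1) (by omega) n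
        (by omega))]
      ring
    · rw [← hM, inner_map_lanczos fun j hj => ih (k + 1) (by omega) j (by omega), hself, hself,
        ih (k + 1) (by omega) k (by omega), mul_zero, sub_zero, ← Complex.ofReal_mul,
        div_mul_cancel₀ _ (by positivity), sub_self]
    · rw [← hM, inner_map_lanczos fun j hj => ih (n + 1) (by omega) j (by omega),
        ih (n + 1) (by omega) k (by omega), ih (n + 1) (by omega) (k + 1) (by omega),
        ih n (by omega) k (by omega)]
      ring

theorem inner_lanczos (hM : M.IsSymmetric) (hv : ∀ n, ‖lanczos M f n‖ ≠ 0) (j k : ℕ) :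
    ⟪lanczos M f j, lanczos M f k⟫_ℂ = if j = k then ((‖lanczos M f j‖ ^ 2 : ℝ) : ℂ) else 0 := by
  split_ifs with h
  · rw [h, inner_self_eq_norm_sq_to_K]
    push_cast
    rfl
  · rcases lt_or_gt_of_ne h with h | h
    · exact inner_lanczos_of_lt hM hv _ _ h
    · exact inner_eq_zero_symm.1 (inner_lanczos_of_lt hM hv _ _ h)

theorem inner_lanczos_pow (hM : M.IsSymmetric) (hv : ∀ n, ‖lanczos M f n‖ ≠ 0) (m : ℕ) :
    (∀ n, m < n → ⟪lanczos M f n, (M ^ m) f⟫_ℂ = 0) ∧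
      ⟪lanczos M f m, (M ^ m) f⟫_ℂ = ((‖lanczos M f m‖ ^ 2 : ℝ) : ℂ) := by
  induction m with
  | zero =>
    refine ⟨fun n hn => ?_, ?_⟩
    · have := inner_lanczos hM hv n 0
      rw [if_neg (by omega)] at this
      simpa [lanczos] using this
    · exact (inner_lanczos hM hv 0 0).trans (if_pos rfl)
  | succ m ih =>
    have step : ∀ n, ⟪lanczos M f (n + 1), (M ^ (m + 1)) f⟫_ℂ =
        ⟪lanczos M f (n + 2), (M ^ m) f⟫_ℂ +
        (rayleighCoeff M (lanczos M f (n + 1)) : ℝ) * ⟪lanczos M f (n + 1), (M ^ m) f⟫_ℂ +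
        ((‖lanczos M f (n + 1)‖ ^ 2 / ‖lanczos M f n‖ ^ 2 : ℝ) : ℂ) *
          ⟪lanczos M f n, (M ^ m) f⟫_ℂ := by
      intro n
      rw [pow_succ', Module.End.mul_apply, ← hM, lanczos.eq_3]
      simp only [inner_sub_left, inner_smul_left, Complex.conj_ofReal]
      ring
    refine ⟨fun n hn => ?_, ?_⟩
    · obtain ⟨n, rfl⟩ : ∃ n', n = n' + 1 := ⟨n - 1, by omega⟩
      rw [step, ih.1 _ (by omega), ih.1 _ (by omega), ih.1 _ (by omega)]
      ring
    · rw [step, ih.1 _ (by omega), ih.1 _ (by omega), ih.2, ← Complex.ofReal_mul,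
        div_mul_cancel₀ _ (pow_ne_zero _ (hv m))]
      ring

theorem norm_lanczos_le (hM : M.IsSymmetric) (hv : ∀ n, ‖lanczos M f n‖ ≠ 0) (m : ℕ) :
    ‖lanczos M f m‖ ≤ ‖(M ^ m) f‖ := by
  have h1 := norm_inner_le_norm (𝕜 := ℂ) (lanczos M f m) ((M ^ m) f)
  rw [(inner_lanczos_pow hM hv m).2, Complex.norm_real, Real.norm_of_nonneg (by positivity),
    sq] at h1
  exact le_of_mul_le_mul_left h1 ((norm_nonneg _).lt_of_ne' (hv m))

/-- A quasi-analytic vector `f` of a symmetric operator `M` is a limit of vectors in the range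
of `M - i`. The approximants can be taken in any `M`-invariant subspace containing `f`. -/
theorem exists_norm_sub_lt_of_quasiAnalytic (hM : M.IsSymmetric) {W : Submodule ℂ E}
    (hW : ∀ w ∈ W, M w ∈ W) (hf : f ∈ W) (t : ℕ → ℝ) (ht : ∀ k, ‖(M ^ (k + 1)) f‖ ≤ t k)
    (hdiv : ¬ Summable fun k : ℕ => t k ^ (-(1 : ℝ) / (k + 1))) {ε : ℝ} (hε : 0 < ε) :
    ∃ g ∈ W, ‖f - (M g - Complex.I • g)‖ < ε := by
  classical
  by_cases hv : ∃ n, ‖lanczos M f n‖ = 0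
  · have hmin := Nat.find_spec hv
    have hlt : ∀ k < Nat.find hv, ‖lanczos M f k‖ ≠ 0 := fun k hk => Nat.find_min hv hk
    set n := Nat.find hv
    have hπ : lanczosSol M f n ≠ 0 :=
      jacobiSol_ne_zero _ _ n fun k hk => by have := hlt k hk; positivity
    obtain ⟨g, hg, hgeq⟩ := lanczos_sub_mem hW hf n
    refine ⟨-((lanczosSol M f n)⁻¹ • g), W.neg_mem (W.smul_mem _ hg), ?_⟩
    have : f - (M (-((lanczosSol M f n)⁻¹ • g)) - Complex.I • -((lanczosSol M f n)⁻¹ • g)) =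
        (lanczosSol M f n)⁻¹ • lanczos M f n := by
      have h1 : M g - Complex.I • g = lanczos M f n - lanczosSol M f n • f := by
        simpa using hgeq
      rw [map_neg, map_smul]
      calc _ = f + (lanczosSol M f n)⁻¹ • (M g - Complex.I • g) := by module
        _ = _ := by rw [h1, smul_sub, smul_smul, inv_mul_cancel₀ hπ]; module
    rw [this, norm_smul, hmin, mul_zero]
    exact hε
  push Not at hv
  by_contra! hcon
  set v := lanczos M f with hvdef
  set p := lanczosSol M f with hp
  set h : ℕ → ℝ := fun n => ‖v n‖ ^ 2 with hh
  have hpos : ∀ n, 0 < h n := fun n => by have := hv n; positivity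
  set S : ℕ → ℝ := fun N => ∑ k ∈ Finset.range N, ‖p k‖ ^ 2 / h k with hS
  have hS0 : ∀ N, 0 ≤ S N := fun N =>
    Finset.sum_nonneg fun k _ => div_nonneg (by positivity) (hpos k).le
  have hbound : ∀ N, S N ≤ 1 / ε ^ 2 := by
    intro N
    rcases (hS0 N).eq_or_lt with h0 | h0
    · rw [← h0]; positivity
    set u : E := ∑ k ∈ Finset.range N, (conj (p k) / (h k : ℂ)) • v k with hu
    have hmem : u - (S N : ℂ) • f ∈ W.map (M - Complex.I • LinearMap.id) := by
      have : u - (S N : ℂ) • f =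
          ∑ k ∈ Finset.range N, (conj (p k) / (h k : ℂ)) • (v k - p k • f) := by
        simp only [smul_sub, Finset.sum_sub_distrib, smul_smul, ← Finset.sum_smul, hu]
        congr 2
        simp only [hS]
        push_cast
        refine Finset.sum_congr rfl fun k _ => ?_
        rw [div_mul_eq_mul_div, ← Complex.normSq_eq_conj_mul_self, Complex.normSq_eq_norm_sq]
        push_cast
        rfl
      rw [this]
      exact Submodule.sum_mem _ fun k _ => Submodule.smul_mem _ _ (lanczos_sub_mem hW hf k)
    have hnorm : ‖u‖ ^ 2 = S N := by
      have h1 : ((‖u‖ ^ 2 : ℝ) : ℂ) = ⟪u, u⟫_ℂ := by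
        rw [inner_self_eq_norm_sq_to_K]; push_cast; rfl
      have h2 : ⟪u, u⟫_ℂ = (S N : ℂ) := by
        simp only [hu, sum_inner, inner_sum, inner_smul_left, inner_smul_right, hvdef,
          inner_lanczos hM hv]
        simp only [hS]
        push_cast
        refine Finset.sum_congr rfl fun k hk => ?_
        rw [Finset.sum_eq_single k]
        · have hk0 : (h k : ℂ) ≠ 0 := by exact_mod_cast (hpos k).ne'
          have hk1 : ((‖lanczos M f k‖ : ℂ)) ^ 2 = (h k : ℂ) := by simp [hh, hvdef]
          simp only [if_true, map_div₀, Complex.conj_conj, Complex.conj_ofReal]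
          rw [hk1, ← Complex.ofReal_pow, ← Complex.normSq_eq_norm_sq,
            Complex.normSq_eq_conj_mul_self]
          field_simp
        · intro j _ hj
          rw [if_neg hj]
          ring
        · exact fun hk' => absurd hk hk'
      exact_mod_cast h1.trans h2
    obtain ⟨g, hg, hgeq⟩ := hmem
    have h1 : M g - Complex.I • g = u - (S N : ℂ) • f := by simpa using hgeq
    have hSne : (S N : ℂ) ≠ 0 := by exact_mod_cast h0.ne'
    have h2 := hcon (-((S N : ℂ)⁻¹ • g)) (W.neg_mem (W.smul_mem _ hg))
    have h3 : f - (M (-((S N : ℂ)⁻¹ • g)) - Complex.I • -((S N : ℂ)⁻¹ • g)) =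
        (S N : ℂ)⁻¹ • u := by
      rw [map_neg, map_smul]
      calc _ = f + (S N : ℂ)⁻¹ • (M g - Complex.I • g) := by module
        _ = _ := by rw [h1, smul_sub, smul_smul, inv_mul_cancel₀ hSne]; module
    rw [h3, norm_smul, norm_inv, Complex.norm_real, Real.norm_of_nonneg h0.le] at h2
    have h4 : ε ^ 2 ≤ ((S N)⁻¹ * ‖u‖) ^ 2 := by gcongr
    rw [mul_pow, hnorm] at h4
    have h5 : (S N)⁻¹ ^ 2 * S N = 1 / S N := by field_simp
    rw [h5, le_div_iff₀ h0] at h4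
    rw [le_div_iff₀ (by positivity)]
    linarith
  have hsum := summable_geomMean_of_summable (fun k => Real.sqrt_nonneg _)
    (summable_of_jacobiSol_bounded _ h hpos _ hbound)
  have hf0 : 0 < ‖f‖ := (norm_nonneg f).lt_of_ne' (hv 0)
  refine hdiv ?_
  refine Summable.of_nonneg_of_le (fun k => ?_) (fun k => ?_)
    (hsum.mul_left (min ‖f‖ 1)⁻¹)
  · exact Real.rpow_nonneg ((norm_nonneg _).trans (ht k)) _
  have hprod : ∏ j ∈ Finset.range (k + 1), √(h j / h (j + 1)) = ‖f‖ / ‖v (k + 1)‖ := by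
    have : ∀ n, ∏ j ∈ Finset.range n, √(h j / h (j + 1)) = ‖f‖ / ‖v n‖ := by
      intro n
      induction n with
      | zero => simp [hvdef, lanczos, hf0.ne']
      | succ n ih =>
        rw [Finset.prod_range_succ, ih, Real.sqrt_div' _ (hpos _).le]
        simp only [hh]
        rw [Real.sqrt_sq (norm_nonneg _), Real.sqrt_sq (norm_nonneg _)]
        have := hv n
        field_simp
    exact this _
  have hvpos : 0 < ‖v (k + 1)‖ := (norm_nonneg _).lt_of_ne' (hv _)
  have hvt : ‖v (k + 1)‖ ≤ t k := (norm_lanczos_le hM hv (k + 1)).trans (ht k)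
  rw [hprod, le_inv_mul_iff₀ (by positivity), neg_div, Real.rpow_neg (hvpos.le.trans hvt),
    Real.div_rpow hf0.le hvpos.le, div_eq_mul_inv]
  have hk1 : (0 : ℝ) < 1 / ((k : ℝ) + 1) := by positivity
  have hmin : min ‖f‖ 1 ≤ ‖f‖ ^ ((1 : ℝ) / (k + 1)) := by
    rcases le_total 1 ‖f‖ with h1 | h1
    · exact (min_le_right _ _).trans (Real.one_le_rpow h1 hk1.le)
    · refine (min_le_left _ _).trans (Real.self_le_rpow_of_le_one hf0.le h1 ?_)
      rw [div_le_one (by positivity)]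
      linarith [(Nat.cast_nonneg k : (0 : ℝ) ≤ k)]
  refine mul_le_mul hmin (inv_anti₀ (Real.rpow_pos_of_pos hvpos _)
    (Real.rpow_le_rpow hvpos.le hvt hk1.le)) (inv_nonneg.2 (Real.rpow_nonneg
    (hvpos.le.trans hvt) _)) (Real.rpow_nonneg hf0.le _)

end Lanczos

section JointCalculus

/-- A finite family of self-adjoint elements of a commutative C⋆-algebra has a joint continuous
functional calculus on `ℝ^ι`, and positive functionals are given by measures on `ℝ^ι`. -/
theorem CommCStarAlgebra.exists_joint_calculus {ι A : Type*} [Fintype ι] [CommCStarAlgebra A]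
    (T : ι → A) (hT : ∀ i, IsSelfAdjoint (T i)) :
    ∃ Φ : C(ι → ℝ, ℝ) →+* A, (∀ i, Φ ⟨fun z => z i, continuous_apply i⟩ = T i) ∧
      (∀ f, IsSelfAdjoint (Φ f)) ∧
      ∀ φ : A →ₗ[ℂ] ℂ, (∀ a, 0 ≤ (φ (star a * a)).re) →
        ∃ m : Measure (ι → ℝ), IsFiniteMeasure m ∧
          ∀ f : C(ι → ℝ, ℝ), Integrable f m ∧ ∫ z, f z ∂m = (φ (Φ f)).re := by
  let X := WeakDual.characterSpace ℂ A
  let Γ := gelfandStarTransform A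
  let z : C(X, ι → ℝ) :=
    ⟨fun χ i => (Γ (T i) χ).re, continuous_pi fun i =>
      Complex.continuous_re.comp (Γ (T i)).continuous⟩
  let c : C(X, ℝ) →+* C(X, ℂ) := Complex.ofRealHom.compLeftContinuous X Complex.continuous_ofReal
  let Ψ : C(X, ℝ) →+* A := (Γ.symm : C(X, ℂ) ≃⋆ₐ[ℂ] A).toRingEquiv.toRingHom.comp c
  have hΨ : ∀ f, Ψ f = Γ.symm (c f) := fun _ => rfl
  have hc : ∀ f, star (c f) = c f := fun f => by
    ext χ
    simp [c]
  have hΨsa : ∀ f, star (Ψ f) = Ψ f := fun f => by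
    rw [hΨ, ← map_star, hc]
  have hΨsmul : ∀ (r : ℝ) f, Ψ (r • f) = (r : ℂ) • Ψ f := fun r f => by
    rw [hΨ, hΨ, ← map_smul]
    congr 1
    ext χ
    simp [c]
  let R : C(ι → ℝ, ℝ) →+* C(X, ℝ) := (ContinuousMap.compRightAlgHom ℝ ℝ z).toRingHom
  have hR : ∀ f χ, R f χ = f (z χ) := fun _ _ => rfl
  refine ⟨Ψ.comp R, fun i => ?_, fun f => hΨsa _, fun φ hφ => ?_⟩
  · rw [RingHom.comp_apply, hΨ]
    have : c (R ⟨fun z => z i, continuous_apply i⟩) = Γ (T i) := by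
      ext χ
      change (((Γ (T i) χ).re : ℝ) : ℂ) = Γ (T i) χ
      rw [← Complex.conj_eq_iff_re]
      have h1 : star (Γ (T i)) = Γ (T i) := by rw [← map_star, (hT i).star_eq]
      exact congrArg (fun g : C(X, ℂ) => g χ) h1
    rw [this]
    exact Γ.symm_apply_apply _
  let : MeasurableSpace X := borel X
  have : BorelSpace X := ⟨rfl⟩
  let Λ₀ : CompactlySupportedContinuousMap X ℝ →ₗ[ℝ] ℝ :=
    { toFun := fun f => (φ (Ψ f.toContinuousMap)).re
      map_add' := fun f g => by
        have : (f + g).toContinuousMap = f.toContinuousMap + g.toContinuousMap := rfl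
        rw [this, map_add, map_add, Complex.add_re]
      map_smul' := fun r f => by
        have : (r • f).toContinuousMap = r • f.toContinuousMap := rfl
        rw [this, hΨsmul, map_smul]
        simp }
  let Λ : CompactlySupportedContinuousMap X ℝ →ₚ[ℝ] ℝ := PositiveLinearMap.mk₀ Λ₀ fun f hf => by
    let s : C(X, ℝ) := ⟨fun χ => √(f χ), f.continuous.sqrt⟩
    have hs : f.toContinuousMap = s * s := by
      ext χ
      exact (Real.mul_self_sqrt (hf χ)).symm
    change 0 ≤ (φ (Ψ f.toContinuousMap)).re
    rw [hs, map_mul]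
    conv_rhs => rw [← hΨsa s]
    have := hφ (Ψ s)
    rwa [hΨsa] at this ⊢
  let m := RealRMK.rieszMeasure Λ
  refine ⟨m.map z, inferInstance, fun f => ?_⟩
  have hz : Measurable z := z.continuous.measurable
  have hRint : Integrable (R f) m :=
    ((CompactlySupportedContinuousMap.continuousMapEquiv (R f)).continuous).integrable_of_hasCompactSupport
      (CompactlySupportedContinuousMap.continuousMapEquiv (R f)).hasCompactSupport
  constructor
  · exact (integrable_map_measure f.continuous.aestronglyMeasurable hz.aemeasurable).2 hRint
  · rw [integral_map hz.aemeasurable f.continuous.aestronglyMeasurable]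
    exact RealRMK.integral_rieszMeasure Λ (CompactlySupportedContinuousMap.continuousMapEquiv (R f))

variable {H : Type*} [NormedAddCommGroup H] [InnerProductSpace ℂ H] [CompleteSpace H]

/-- A finite commuting family of bounded self-adjoint operators has a joint continuous functional
calculus on `ℝ^ι`, with a spectral measure for every vector. -/
theorem exists_joint_spectral_measure {ι : Type*} [Fintype ι] (T : ι → H →L[ℂ] H)
    (hT : ∀ i, IsSelfAdjoint (T i)) (hcomm : ∀ i j, T i * T j = T j * T i) :
    ∃ Φ : C(ι → ℝ, ℝ) →+* (H →L[ℂ] H),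
      (∀ i, Φ ⟨fun z => z i, continuous_apply i⟩ = T i) ∧ (∀ f, IsSelfAdjoint (Φ f)) ∧
      ∀ w : H, ∃ m : Measure (ι → ℝ), IsFiniteMeasure m ∧
        ∀ f : C(ι → ℝ, ℝ), Integrable f m ∧ ∫ z, f z ∂m = (⟪w, Φ f w⟫_ℂ).re := by
  let S := StarAlgebra.adjoin ℂ (Set.range T)
  have hS : ∀ x y : S, x * y = y * x := by
    have := StarAlgebra.isMulCommutative_adjoin ℂ (s := Set.range T)
      (by rintro _ ⟨i, rfl⟩ _ ⟨j, rfl⟩; exact hcomm i j)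
      (by rintro _ ⟨i, rfl⟩ _ ⟨j, rfl⟩; rw [(hT j).star_eq]; exact hcomm i j)
    exact fun x y => mul_comm' x y
  let A := S.topologicalClosure
  have hA : ∀ x y : A, x * y = y * x := by
    let := StarSubalgebra.commRingTopologicalClosure S hS
    exact fun x y => mul_comm x y
  have : IsClosed (A : Set (H →L[ℂ] H)) := S.isClosed_topologicalClosure
  let : CommCStarAlgebra A := { StarSubalgebra.cstarAlgebra A with mul_comm := hA }
  let T' : ι → A := fun i =>
    ⟨T i, S.le_topologicalClosure (StarAlgebra.subset_adjoin ℂ _ ⟨i, rfl⟩)⟩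
  obtain ⟨Φ, h1, h2, h3⟩ := CommCStarAlgebra.exists_joint_calculus T'
    fun i => Subtype.ext (hT i)
  refine ⟨(A.subtype : A →+* (H →L[ℂ] H)).comp Φ, fun i => ?_, fun f => ?_, fun w => ?_⟩
  · exact congrArg Subtype.val (h1 i)
  · exact congrArg Subtype.val (h2 f)
  · let φ : A →ₗ[ℂ] ℂ :=
      { toFun := fun a => ⟪w, (a : H →L[ℂ] H) w⟫_ℂ
        map_add' := fun a b => inner_add_right _ _ _
        map_smul' := fun r a => inner_smul_right _ _ _ }
    exact h3 φ fun a => by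
      change 0 ≤ (⟪w, (star (a : H →L[ℂ] H) * (a : H →L[ℂ] H)) w⟫_ℂ).re
      rw [ContinuousLinearMap.star_eq_adjoint, mul_apply_eq_comp,
        ContinuousLinearMap.adjoint_inner_right]
      exact inner_self_nonneg (𝕜 := ℂ)

end JointCalculus

section Existence

variable {E : Type*} [SeminormedAddCommGroup E] [InnerProductSpace ℂ E]

open UniformSpace (Completion)

/-- For `A` relatively bounded by `D` and `D` of dense range, the bounded extension of
`D g ↦ A g` to the completion. -/
noncomputable def quotientOp (A D : E →ₗ[ℂ] E) : Completion E →L[ℂ] Completion E :=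
  ((Completion.toComplₗᵢ (𝕜 := ℂ) (E := E)).toLinearMap ∘ₗ A).extendOfNorm
    ((Completion.toComplₗᵢ (𝕜 := ℂ) (E := E)).toLinearMap ∘ₗ D)

theorem quotientOp_apply {A D : E →ₗ[ℂ] E} (hD : DenseRange fun g => (D g : Completion E))
    (hA : ∀ g, ‖A g‖ ≤ ‖D g‖) (g : E) : quotientOp A D (D g : Completion E) = (A g : E) :=
  LinearMap.extendOfNorm_eq (f := (Completion.toComplₗᵢ (𝕜 := ℂ) (E := E)).toLinearMap ∘ₗ A)
    (e := (Completion.toComplₗᵢ (𝕜 := ℂ) (E := E)).toLinearMap ∘ₗ D) hD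
    ⟨1, fun x => by simpa using hA x⟩ g

theorem isSelfAdjoint_quotientOp {A D : E →ₗ[ℂ] E}
    (hD : DenseRange fun g => (D g : Completion E))
    (hA : ∀ g, ‖A g‖ ≤ ‖D g‖) (hsym : ∀ g h, ⟪A g, D h⟫_ℂ = ⟪D g, A h⟫_ℂ) :
    IsSelfAdjoint (quotientOp A D) := by
  rw [ContinuousLinearMap.isSelfAdjoint_iff_isSymmetric]
  intro x y
  refine hD.induction_on₂ (p := fun x y => ⟪quotientOp A D x, y⟫_ℂ = ⟪x, quotientOp A D y⟫_ℂ)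
    (isClosed_eq (by fun_prop) (by fun_prop)) (fun g h => ?_) x y
  simp only [quotientOp_apply hD hA, Completion.inner_coe]
  exact hsym g h

theorem norm_le_norm_add_sq {M : E →ₗ[ℂ] E} (hM : M.IsSymmetric) (g : E) :
    ‖g‖ ≤ ‖g + M (M g)‖ ∧ ‖M g‖ ≤ ‖g + M (M g)‖ := by
  have h1 : ‖g + M (M g)‖ ^ 2 = ‖g‖ ^ 2 + 2 * ‖M g‖ ^ 2 + ‖M (M g)‖ ^ 2 := by
    rw [@norm_add_sq ℂ, ← hM g (M g), ← @norm_sq_eq_re_inner ℂ]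
  constructor <;> refine le_of_sq_le_sq ?_ (norm_nonneg _) <;>
    nlinarith [sq_nonneg ‖g‖, sq_nonneg ‖M g‖, sq_nonneg ‖M (M g)‖]

variable {n : ℕ} (ρ : MvPolynomial (Fin n) ℂ →ₐ[ℂ] Module.End ℂ E)

theorem exists_measure_of_dense (hsym : ∀ i, (ρ (X i)).IsSymmetric)
    (hdense : ∀ i j, ∀ f : E, ∀ ε : ℝ, 0 < ε →
      ∃ g, ‖f - ρ ((1 + X i ^ 2) * (1 + X j ^ 2)) g‖ < ε) (e : E) :
    ∃ μ : Measure (Fin n → ℝ), ∀ α : Fin n → ℕ,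
      Integrable (fun x : Fin n → ℝ => ∏ i, x i ^ α i) μ ∧
      ∫ x, ∏ i, x i ^ α i ∂μ = (⟪e, ρ (∏ i, X i ^ α i) e⟫_ℂ).re := by
  set D : Fin n → MvPolynomial (Fin n) ℂ := fun i => 1 + X i ^ 2 with hDdef
  have hρ : ∀ p q g, ρ (p * q) g = ρ p (ρ q g) := fun p q g => by rw [map_mul]; rfl
  have hDapp : ∀ i g, ρ (D i) g = g + ρ (X i) (ρ (X i) g) := fun i g => by
    simp [hDdef, pow_two]
  have hDsym : ∀ i g h, ⟪ρ (D i) g, h⟫_ℂ = ⟪g, ρ (D i) h⟫_ℂ := fun i g h => by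
    rw [hDapp, hDapp, inner_add_left, inner_add_right, hsym i, hsym i]
  have hDD : ∀ i j, DenseRange fun g => (ρ (D i * D j) g : Completion E) := fun i j => by
    have h1 : DenseRange fun g => ρ (D i * D j) g := Metric.denseRange_iff.2 fun f ε hε => by
      obtain ⟨g, hg⟩ := hdense i j f ε hε
      exact ⟨g, by rwa [dist_eq_norm]⟩
    exact Completion.denseRange_coe.comp h1 (Completion.continuous_coe E)
  have hD : ∀ i, DenseRange fun g => (ρ (D i) g : Completion E) := fun i => by
    refine (hDD i i).mono ?_
    rintro _ ⟨g, rfl⟩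
    exact ⟨ρ (D i) g, by simp only [hρ]⟩
  let a : Fin n ⊕ Fin n → MvPolynomial (Fin n) ℂ := Sum.elim (fun _ => 1) X
  let ix : Fin n ⊕ Fin n → Fin n := Sum.elim id id
  have ha : ∀ s g, ‖ρ (a s) g‖ ≤ ‖ρ (D (ix s)) g‖ := by
    rintro (i | i) g
    · simpa [a, ix, hDapp] using (norm_le_norm_add_sq (hsym i) g).1
    · simpa [a, ix, hDapp] using (norm_le_norm_add_sq (hsym i) g).2
  have hasym : ∀ s g h, ⟪ρ (a s) g, h⟫_ℂ = ⟪g, ρ (a s) h⟫_ℂ := by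
    rintro (i | i) g h
    · simp [a]
    · exact hsym i g h
  let T : Fin n ⊕ Fin n → Completion E →L[ℂ] Completion E := fun s =>
    quotientOp (ρ (a s)) (ρ (D (ix s)))
  have hT : ∀ s g, T s (ρ (D (ix s)) g : E) = (ρ (a s) g : E) := fun s g =>
    quotientOp_apply (hD _) (ha s) g
  have hTsa : ∀ s, IsSelfAdjoint (T s) := fun s =>
    isSelfAdjoint_quotientOp (hD _) (ha s) fun g h => by
      rw [hasym, ← hρ, mul_comm, hρ, hDsym]
  have hTcomm : ∀ s t, T s * T t = T t * T s := fun s t => by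
    refine ContinuousLinearMap.ext fun x => ?_
    have hTT : ∀ s t g, T s (T t (ρ (D (ix s) * D (ix t)) g : E)) = (ρ (a s * a t) g : E) :=
      fun s t g => by
        rw [mul_comm (D (ix s)), hρ, hT t, ← hρ, mul_comm (a t), hρ, hT s, ← hρ]
    refine congrFun ((hDD (ix s) (ix t)).equalizer (T s * T t).continuous
      (T t * T s).continuous ?_) x
    funext g
    simp only [Function.comp, mul_apply_eq_comp]
    rw [hTT, mul_comm (D (ix s)), hTT, mul_comm]
  obtain ⟨Φ, hΦT, hΦsa, hΦm⟩ := exists_joint_spectral_measure T hTsa hTcomm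
  have hprod : ∀ (α : Fin n → ℕ) (s : Fin n → Fin n ⊕ Fin n), (∀ i, ix (s i) = i) → ∀ g : E,
      Φ (∏ i, (⟨fun z => z (s i), continuous_apply _⟩ : C(Fin n ⊕ Fin n → ℝ, ℝ)) ^ α i)
        (ρ (∏ i, D i ^ α i) g : E) = (ρ (∏ i, a (s i) ^ α i) g : E) := by
    intro α s hs
    let S : Submonoid (C(Fin n ⊕ Fin n → ℝ, ℝ) × MvPolynomial (Fin n) ℂ ×
        MvPolynomial (Fin n) ℂ) :=
      { carrier := {q | ∀ g : E, Φ q.1 (ρ q.2.1 g : E) = (ρ q.2.2 g : E)}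
        one_mem' := fun g => by simp
        mul_mem' := fun {p q} hp hq g => by
          simp only [Set.mem_ofPred_eq] at hp hq
          simp only [Prod.fst_mul, Prod.snd_mul, map_mul Φ, mul_apply_eq_comp]
          rw [mul_comm p.2.1, hρ, hq, ← hρ, mul_comm, hρ, hp, ← hρ] }
    have hmem : ∏ i, ((⟨fun z => z (s i), continuous_apply _⟩ : C(Fin n ⊕ Fin n → ℝ, ℝ)),
        D i, a (s i)) ^ α i ∈ S := S.prod_mem fun i _ => S.pow_mem (fun g => by
      simp only [hΦT]
      have := hT (s i) g
      rwa [hs] at this) _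
    intro g
    have := hmem g
    simpa [Prod.fst_prod, Prod.snd_prod] using this
  obtain ⟨m, hmfin, hm⟩ := hΦm e
  let x : (Fin n ⊕ Fin n → ℝ) → Fin n → ℝ := fun z i => z (Sum.inr i) / z (Sum.inl i)
  have hx : Measurable x := by fun_prop
  refine ⟨m.map x, fun α => ?_⟩
  let w : E := ρ (∏ i, D i ^ α i) e
  obtain ⟨m', hm'fin, hm'⟩ := hΦm w
  let b : C(Fin n ⊕ Fin n → ℝ, ℝ) := ∏ i, ⟨fun z => z (Sum.inl i), continuous_apply _⟩ ^ α i
  let c : C(Fin n ⊕ Fin n → ℝ, ℝ) := ∏ i, ⟨fun z => z (Sum.inr i), continuous_apply _⟩ ^ α i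
  have hb : Φ b w = e := by simpa [a] using hprod α Sum.inl (fun _ => rfl) e
  have hc : Φ c w = (ρ (∏ i, X i ^ α i) e : E) := hprod α Sum.inr (fun _ => rfl) e
  have hΦsym : ∀ f u v, ⟪Φ f u, v⟫_ℂ = ⟪u, Φ f v⟫_ℂ := fun f u v =>
    ContinuousLinearMap.isSelfAdjoint_iff_isSymmetric.1 (hΦsa f) u v
  have hwd : m = m'.withDensity fun z => ENNReal.ofReal (b z ^ 2) := by
    have : IsFiniteMeasure (m'.withDensity fun z => ENNReal.ofReal (b z ^ 2)) :=
      isFiniteMeasure_withDensity_ofReal (hm' (b ^ 2)).1.2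
    refine ext_of_forall_integral_eq_of_IsFiniteMeasure fun f => ?_
    rw [integral_withDensity_eq_integral_toReal_smul (by fun_prop) (by simp)]
    have h1 := (hm f.toContinuousMap).2
    have h2 := (hm' (b * f.toContinuousMap * b)).2
    simp only [map_mul, mul_apply_eq_comp] at h2
    rw [← hΦsym, hb, ← h1] at h2
    refine h2.symm.trans (integral_congr_ae (.of_forall fun z => ?_))
    simp [ENNReal.toReal_ofReal, sq_nonneg]
    ring
  have hpt : ∀ z, b z ^ 2 * ∏ i, x z i ^ α i = (b * c) z := fun z => by
    simp only [b, c, x, ContinuousMap.mul_apply, ContinuousMap.coe_prod, ContinuousMap.coe_pow,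
      Finset.prod_apply, Pi.pow_apply, ContinuousMap.coe_mk, ← Finset.prod_pow,
      ← Finset.prod_mul_distrib]
    refine Finset.prod_congr rfl fun i _ => ?_
    rcases Nat.eq_zero_or_pos (α i) with h | h
    · simp [h]
    · by_cases hz : z (Sum.inl i) = 0
      · simp [hz, h.ne']
      · rw [div_pow]
        field_simp
  have hmeas : AEStronglyMeasurable (fun x : Fin n → ℝ => ∏ i, x i ^ α i) (m.map x) :=
    Continuous.aestronglyMeasurable (by fun_prop)
  constructor
  · rw [integrable_map_measure hmeas hx.aemeasurable, hwd,
      integrable_withDensity_iff_integrable_smul' (by fun_prop) (by simp)]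
    refine (hm' (b * c)).1.congr (.of_forall fun z => ?_)
    simp [ENNReal.toReal_ofReal, sq_nonneg, ← hpt]
  · rw [integral_map hx.aemeasurable hmeas]
    have h1 := (hm' (b * c)).2
    rw [map_mul, mul_apply_eq_comp, ← hΦsym, hb, hc, Completion.inner_coe]
      at h1
    rw [← h1, hwd, integral_withDensity_eq_integral_toReal_smul (by fun_prop) (by simp)]
    refine integral_congr_ae (.of_forall fun z => ?_)
    simp [ENNReal.toReal_ofReal, sq_nonneg, ← hpt]

end Existence

section Carleman

theorem logConvex_pow_succ_le {N : ℕ → ℝ} (h0 : ∀ m, 0 ≤ N m)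
    (hN : ∀ m, N (m + 1) ^ 2 ≤ N m * N (m + 2)) (m : ℕ) :
    N m ^ (m + 1) ≤ N 0 * N (m + 1) ^ m := by
  induction m with
  | zero => simp
  | succ m ih =>
    rcases (h0 (m + 1)).eq_or_lt with h | h
    · rw [← h, zero_pow (by omega)]
      exact mul_nonneg (h0 0) (pow_nonneg (h0 _) _)
    · refine le_of_mul_le_mul_left ?_ (pow_pos h m)
      calc N (m + 1) ^ m * N (m + 1) ^ (m + 1 + 1) = (N (m + 1) ^ 2) ^ (m + 1) := by ring
        _ ≤ (N m * N (m + 2)) ^ (m + 1) := by gcongr; exact hN m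
        _ = N m ^ (m + 1) * N (m + 2) ^ (m + 1) := mul_pow ..
        _ ≤ N 0 * N (m + 1) ^ m * N (m + 2) ^ (m + 1) :=
          mul_le_mul_of_nonneg_right ih (pow_nonneg (h0 _) _)
        _ = N (m + 1) ^ m * (N 0 * N (m + 1 + 1) ^ (m + 1)) := by ring

theorem logConvex_rpow_le {N : ℕ → ℝ} (h0 : ∀ m, 0 ≤ N m)
    (hN : ∀ m, N (m + 1) ^ 2 ≤ N m * N (m + 2)) {m : ℕ} (hm : 0 < m) :
    N (m + 1) ^ (-(1 : ℝ) / (m + 1)) ≤ max 1 (N 0) * N m ^ (-(1 : ℝ) / m) := by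
  have hm' : (0 : ℝ) < m := by exact_mod_cast hm
  have hne : -(1 : ℝ) / (m + 1) ≠ 0 := by
    rw [neg_div, neg_ne_zero]; positivity
  rcases (h0 (m + 1)).eq_or_lt with h | h
  · rw [← h, Real.zero_rpow hne]
    exact mul_nonneg (le_max_of_le_left zero_le_one) (Real.rpow_nonneg (h0 _) _)
  have hNm : 0 < N m := (h0 m).lt_of_ne fun h' => by
    have := hN m
    rw [← h', zero_mul] at this
    nlinarith
  have h1 : N (m + 1) ^ m ≠ 0 := by positivity
  have key : N m ^ (m + 1) ≤ max 1 (N 0) * N (m + 1) ^ m :=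
    (logConvex_pow_succ_le h0 hN m).trans (by gcongr; exact le_max_right _ _)
  have hK : 1 ≤ max 1 (N 0) := le_max_left _ _
  have hK0 : 0 < max 1 (N 0) := by positivity
  generalize max 1 (N 0) = K at *
  rw [← Real.log_le_log_iff (by positivity) (by positivity),
    Real.log_mul (by positivity) (by positivity), Real.log_pow, Real.log_pow] at key
  rw [← Real.log_le_log_iff (by positivity) (by positivity),
    Real.log_mul (by positivity) (by positivity), Real.log_rpow h, Real.log_rpow hNm]
  have hlK : 0 ≤ Real.log K := Real.log_nonneg hK
  push_cast at key
  have h1m : (1 : ℝ) ≤ m := by exact_mod_cast hm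
  have : 0 ≤ Real.log K + -1 / m * Real.log (N m) - -1 / (m + 1) * Real.log (N (m + 1)) := by
    have e : Real.log K + -1 / m * Real.log (N m) - -1 / (m + 1) * Real.log (N (m + 1)) =
      (m * (m + 1) * Real.log K - (m + 1) * Real.log (N m) + m * Real.log (N (m + 1))) /
        (m * (m + 1)) := by field_simp; ring
    rw [e]
    apply div_nonneg _ (by positivity)
    nlinarith [mul_nonneg (sub_nonneg.2 h1m) hlK, mul_nonneg hm'.le hlK]
  linarith

theorem summable_rpow_of_summable_even {N : ℕ → ℝ} (h0 : ∀ m, 0 ≤ N m)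
    (hN : ∀ m, N (m + 1) ^ 2 ≤ N m * N (m + 2))
    (h : Summable fun k : ℕ => N (2 * (k + 1)) ^ (-(1 : ℝ) / (2 * (k + 1)))) :
    Summable fun k : ℕ => N (k + 1) ^ (-(1 : ℝ) / (k + 1)) := by
  rw [← summable_nat_add_iff 1]
  have ho : Summable fun k : ℕ => N (2 * (k + 1) + 1) ^ (-(1 : ℝ) / (2 * (k + 1) + 1)) := by
    refine .of_nonneg_of_le (fun k => Real.rpow_nonneg (h0 _) _) (fun k => ?_)
      (h.mul_left (max 1 (N 0)))
    have := logConvex_rpow_le h0 hN (m := 2 * (k + 1)) (by omega)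
    push_cast at this
    exact this
  refine Summable.even_add_odd (f := fun k : ℕ => N (k + 1 + 1) ^ (-(1 : ℝ) / ((k + 1 : ℕ) + 1)))
    ?_ ?_
  · convert h using 3
    congr 1
    push_cast; ring
  · convert ho using 3
    congr 1
    push_cast; ring

end Carleman

section Density

variable {E : Type*} [SeminormedAddCommGroup E] [InnerProductSpace ℂ E]
variable {n : ℕ} (ρ : MvPolynomial (Fin n) ℂ →ₐ[ℂ] Module.End ℂ E)

theorem exists_adjoint (hsym : ∀ i, (ρ (X i)).IsSymmetric) (p : MvPolynomial (Fin n) ℂ) :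
    ∃ q, ∀ g h, ⟪ρ p g, h⟫_ℂ = ⟪g, ρ q h⟫_ℂ := by
  induction p using MvPolynomial.induction_on with
  | C z => 
    refine ⟨C (conj z), fun g h => ?_⟩
    rw [← algebraMap_eq, AlgHom.commutes, AlgHom.commutes]
    simp [inner_smul_left, inner_smul_right]
  | add p q hp hq =>
    obtain ⟨p', hp⟩ := hp
    obtain ⟨q', hq⟩ := hq
    exact ⟨p' + q', fun g h => by simp [inner_add_left, inner_add_right, hp, hq]⟩
  | mul_X p i hp =>
    obtain ⟨p', hp⟩ := hp
    exact ⟨X i * p', fun g h => by simp [hp, hsym i _ _]⟩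

/-- In a cyclic representation, a Carleman condition at the cyclic vector propagates to all
vectors. -/
theorem exists_norm_pow_le_of_carleman (hsym : ∀ i, (ρ (X i)).IsSymmetric) {e : E}
    (hcyc : ∀ f, ∃ p, ρ p e = f) {i : Fin n}
    (hcarl : ¬ Summable fun k : ℕ => ‖ρ (X i ^ (k + 1)) e‖ ^ (-(1 : ℝ) / (k + 1))) (f : E) :
    ∃ t : ℕ → ℝ, (∀ k, ‖(ρ (X i) ^ (k + 1)) f‖ ≤ t k) ∧
      ¬ Summable fun k : ℕ => t k ^ (-(1 : ℝ) / (k + 1)) := by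
  have hρ : ∀ p q g, ρ (p * q) g = ρ p (ρ q g) := fun p q g => by rw [map_mul]; rfl
  obtain ⟨r, rfl⟩ := hcyc f
  obtain ⟨r', hr⟩ := exists_adjoint ρ hsym r
  have hpow : ∀ m g h, ⟪ρ (X i ^ m) g, h⟫_ℂ = ⟪g, ρ (X i ^ m) h⟫_ℂ := fun m g h => by
    rw [map_pow]; exact (hsym i).pow m g h
  set N : ℕ → ℝ := fun m => ‖ρ (X i ^ m) e‖ with hNdef
  have hNconv : ∀ m, N (m + 1) ^ 2 ≤ N m * N (m + 2) := fun m => by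
    have h1 : ⟪ρ (X i ^ (m + 1)) e, ρ (X i ^ (m + 1)) e⟫_ℂ =
        ⟪ρ (X i ^ m) e, ρ (X i ^ (m + 2)) e⟫_ℂ := by
      rw [hpow, hpow, ← hρ, ← hρ, ← pow_add, ← pow_add, show m + 1 + (m + 1) = m + (m + 2) by omega]
    rw [hNdef, @norm_sq_eq_re_inner ℂ, h1]
    exact re_inner_le_norm _ _
  set K := ‖ρ r' (ρ r e)‖ with hK
  have hK1 : 1 ≤ K + 1 := by simp [hK]
  refine ⟨fun k => √((K + 1) * N (2 * (k + 1))), fun k => Real.le_sqrt_of_sq_le ?_, fun hs => ?_⟩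
  · have h1 : ⟪ρ (X i ^ (k + 1)) (ρ r e), ρ (X i ^ (k + 1)) (ρ r e)⟫_ℂ =
        ⟪ρ r' (ρ r e), ρ (X i ^ (2 * (k + 1))) e⟫_ℂ := by
      rw [hpow, ← hρ, ← hρ, ← pow_add, ← two_mul, mul_comm, hρ, ← inner_conj_symm, hr,
        inner_conj_symm]
    rw [← map_pow, @norm_sq_eq_re_inner ℂ, h1]
    refine (re_inner_le_norm _ _).trans ?_
    exact mul_le_mul_of_nonneg_right (le_add_of_nonneg_right zero_le_one) (norm_nonneg _)
  · refine hcarl (summable_rpow_of_summable_even (N := N) (fun m => norm_nonneg _) hNconv ?_)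
    refine .of_nonneg_of_le (fun k => Real.rpow_nonneg (norm_nonneg _) _) (fun k => ?_)
      (hs.mul_left (K + 1))
    have hN0 : 0 ≤ N (2 * (k + 1)) := norm_nonneg _
    have h2 : (√((K + 1) * N (2 * (k + 1)))) ^ (-(1 : ℝ) / (k + 1)) =
        (K + 1) ^ (-(1 : ℝ) / (2 * (k + 1))) * N (2 * (k + 1)) ^ (-(1 : ℝ) / (2 * (k + 1))) := by
      rw [Real.sqrt_eq_rpow, ← Real.rpow_mul (by positivity), Real.mul_rpow (by positivity) hN0]
      congr 2 <;> field_simp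
    rw [h2, ← mul_assoc]
    refine le_mul_of_one_le_left (Real.rpow_nonneg hN0 _) ?_
    rw [← Real.rpow_one_add' (by positivity)]
    · refine Real.one_le_rpow hK1 ?_
      rw [neg_div, ← sub_eq_add_neg, sub_nonneg, div_le_one (by positivity)]
      have : (0 : ℝ) ≤ k := by positivity
      linarith
    · rw [neg_div, ← sub_eq_add_neg, sub_ne_zero]
      refine (ne_of_lt ?_).symm
      rw [div_lt_one (by positivity)]
      have : (0 : ℝ) ≤ k := by positivity
      linarith

theorem exists_norm_sub_lt_of_carleman (hsym : ∀ i, (ρ (X i)).IsSymmetric) {e : E}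
    (hcyc : ∀ f, ∃ p, ρ p e = f)
    (hcarl : ∀ i, ¬ Summable fun k : ℕ => ‖ρ (X i ^ (k + 1)) e‖ ^ (-(1 : ℝ) / (k + 1)))
    (i j : Fin n) (f : E) {ε : ℝ} (hε : 0 < ε) :
    ∃ g, ‖f - ρ ((1 + X i ^ 2) * (1 + X j ^ 2)) g‖ < ε := by
  have hρ : ∀ p q g, ρ (p * q) g = ρ p (ρ q g) := fun p q g => by rw [map_mul]; rfl
  have hCI : ∀ g, ρ (C Complex.I) g = Complex.I • g := fun g => by
    rw [← algebraMap_eq, AlgHom.commutes]; rfl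
  let P : MvPolynomial (Fin n) ℂ → Prop := fun q => ∀ f, ∀ ε : ℝ, 0 < ε → ∃ g, ‖f - ρ q g‖ < ε
  have hstep : ∀ q q', (∀ f, ∀ ε : ℝ, 0 < ε → ∃ g, ‖ρ q f - ρ (q * q') g‖ < ε) → P q →
      P (q * q') := fun q q' h hq f ε hε => by
    obtain ⟨g, hg⟩ := hq f (ε / 2) (by positivity)
    obtain ⟨g', hg'⟩ := h g (ε / 2) (by positivity)
    refine ⟨g', ?_⟩
    calc _ = ‖(f - ρ q g) + (ρ q g - ρ (q * q') g')‖ := by congr 1; abel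
      _ ≤ _ := norm_add_le _ _
      _ < ε := by linarith
  have hinv : ∀ q i, ∀ w ∈ LinearMap.range (ρ q), ρ (X i) w ∈ LinearMap.range (ρ q) := by
    rintro q i _ ⟨g, rfl⟩
    exact ⟨ρ (X i) g, by rw [← hρ, ← hρ, mul_comm]⟩
  have hsub : ∀ i q, P q → P (q * (X i - C Complex.I)) := fun i q => hstep _ _ fun f ε hε => by
    obtain ⟨t, ht, hdiv⟩ := exists_norm_pow_le_of_carleman ρ hsym hcyc (hcarl i) (ρ q f)
    obtain ⟨_, ⟨g, rfl⟩, hg⟩ := exists_norm_sub_lt_of_quasiAnalytic (hsym i) (hinv q i)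
      (LinearMap.mem_range_self (ρ q) f) t ht hdiv hε
    refine ⟨g, ?_⟩
    rwa [mul_comm q, hρ, map_sub, LinearMap.sub_apply, hCI]
  have hadd : ∀ i q, P q → P (q * (X i + C Complex.I)) := fun i q => hstep _ _ fun f ε hε => by
    obtain ⟨t, ht, hdiv⟩ := exists_norm_pow_le_of_carleman ρ hsym hcyc (hcarl i) (ρ q f)
    obtain ⟨_, ⟨g, rfl⟩, hg⟩ := exists_norm_sub_lt_of_quasiAnalytic (M := -ρ (X i))
      (fun u v => by simp [hsym i u v])
      (fun w hw => neg_mem (hinv q i w hw))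
      (LinearMap.mem_range_self (ρ q) f) t (fun k => by
        rcases neg_one_pow_eq_or (Module.End ℂ E) (k + 1) with h | h <;>
        simpa [neg_pow (ρ (X i)), h] using ht k) hdiv hε
    refine ⟨-g, ?_⟩
    rw [mul_comm q, hρ, map_add, LinearMap.add_apply, hCI]
    convert hg using 2
    simp [sub_eq_add_neg]
  have hfac : ∀ i : Fin n, (1 + X i ^ 2 : MvPolynomial (Fin n) ℂ) =
      (X i - C Complex.I) * (X i + C Complex.I) := fun i => by
    have : (C Complex.I : MvPolynomial (Fin n) ℂ) ^ 2 = -1 := by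
      rw [← map_pow, Complex.I_sq, map_neg, map_one]
    linear_combination this
  have hfin := hadd j _ (hsub j _ (hadd i _ (hsub i 1 fun f ε hε => ⟨f, by simpa using hε⟩)))
  rw [one_mul, mul_assoc, ← hfac, ← hfac] at hfin
  exact hfin f ε hε

end Density

section Riesz

variable {n : ℕ} (y : (Fin n → ℕ) → ℝ)

/-- The Riesz functional as a linear map. -/
noncomputable def rieszLinear : MvPolynomial (Fin n) ℝ →ₗ[ℝ] ℝ :=
  (basisMonomials (Fin n) ℝ).constr ℝ fun α => y α

theorem rieszLinear_monomial (α : Fin n →₀ ℕ) (c : ℝ) :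
    rieszLinear y (monomial α c) = c * y α := by
  have h : monomial α c = c • basisMonomials (Fin n) ℝ α := by simp [smul_monomial]
  rw [h, map_smul, rieszLinear, Module.Basis.constr_basis, smul_eq_mul]

theorem rieszFunctional_eq_rieszLinear (p : MvPolynomial (Fin n) ℝ) :
    rieszFunctional y p = rieszLinear y p := by
  conv_rhs => rw [p.as_sum, map_sum]
  simp [rieszFunctional, rieszLinear_monomial]

/-- The complex-linear extension of the Riesz functional. -/
noncomputable def rieszComplex : MvPolynomial (Fin n) ℂ →ₗ[ℂ] ℂ :=
  (basisMonomials (Fin n) ℂ).constr ℂ fun α => (y α : ℂ)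

theorem rieszComplex_monomial (α : Fin n →₀ ℕ) (c : ℂ) :
    rieszComplex y (monomial α c) = c * y α := by
  have h : monomial α c = c • basisMonomials (Fin n) ℂ α := by simp [smul_monomial]
  rw [h, map_smul, rieszComplex, Module.Basis.constr_basis, smul_eq_mul]

theorem rieszComplex_map_ofReal (p : MvPolynomial (Fin n) ℝ) :
    rieszComplex y (map Complex.ofRealHom p) = rieszFunctional y p := by
  rw [rieszFunctional_eq_rieszLinear]
  induction p using MvPolynomial.induction_on' with
  | monomial α c => simp [map_monomial, rieszComplex_monomial, rieszLinear_monomial]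
  | add p q hp hq => simp [hp, hq]

theorem rieszComplex_map_conj (p : MvPolynomial (Fin n) ℂ) :
    rieszComplex y (map (starRingEnd ℂ) p) = conj (rieszComplex y p) := by
  induction p using MvPolynomial.induction_on' with
  | monomial α c => simp [map_monomial, rieszComplex_monomial]
  | add p q hp hq => simp [hp, hq]

theorem exists_eq_map_add_I_mul_map (p : MvPolynomial (Fin n) ℂ) :
    ∃ a b : MvPolynomial (Fin n) ℝ,
      p = map Complex.ofRealHom a + C Complex.I * map Complex.ofRealHom b := by
  induction p using MvPolynomial.induction_on with
  | C z =>
    refine ⟨C z.re, C z.im, ?_⟩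
    rw [map_C, map_C, ← C_mul, ← C_add, mul_comm]
    exact congrArg C (Complex.re_add_im z).symm
  | add p q hp hq =>
    obtain ⟨a, b, rfl⟩ := hp
    obtain ⟨a', b', rfl⟩ := hq
    exact ⟨a + a', b + b', by simp only [map_add]; ring⟩
  | mul_X p i hp =>
    obtain ⟨a, b, rfl⟩ := hp
    exact ⟨a * X i, b * X i, by simp only [map_mul, map_X]; ring⟩

theorem map_conj_map_ofReal (a : MvPolynomial (Fin n) ℝ) :
    map (starRingEnd ℂ) (map Complex.ofRealHom a) = map Complex.ofRealHom a := by
  rw [map_map]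
  congr 2
  ext x
  simp

theorem rieszComplex_conj_mul_self_nonneg (hpsd : ∀ p, 0 ≤ rieszFunctional y (p ^ 2))
    (p : MvPolynomial (Fin n) ℂ) :
    0 ≤ (rieszComplex y (map (starRingEnd ℂ) p * p)).re := by
  obtain ⟨a, b, rfl⟩ := exists_eq_map_add_I_mul_map p
  have h : map (starRingEnd ℂ) (map Complex.ofRealHom a + C Complex.I * map Complex.ofRealHom b) *
      (map Complex.ofRealHom a + C Complex.I * map Complex.ofRealHom b) =
      map Complex.ofRealHom (a ^ 2) + map Complex.ofRealHom (b ^ 2) := by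
    have hI : (C Complex.I : MvPolynomial (Fin n) ℂ) ^ 2 = -1 := by
      rw [← map_pow, Complex.I_sq, map_neg, map_one]
    simp only [map_add, map_mul, map_C, map_conj_map_ofReal, Complex.conj_I, map_neg, map_pow]
    linear_combination (-map Complex.ofRealHom b ^ 2) * hI
  rw [h, map_add, rieszComplex_map_ofReal, rieszComplex_map_ofReal, ← Complex.ofReal_add,
    Complex.ofReal_re]
  exact add_nonneg (hpsd a) (hpsd b)

/-- The Gelfand–Naimark–Segal representation of a positive functional on polynomials. -/
theorem exists_cyclic_representation (hpsd : ∀ p, 0 ≤ rieszFunctional y (p ^ 2)) :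
    ∃ (E : Type) (_ : SeminormedAddCommGroup E) (_ : InnerProductSpace ℂ E)
      (ρ : MvPolynomial (Fin n) ℂ →ₐ[ℂ] Module.End ℂ E) (e : E),
      (∀ i, (ρ (X i)).IsSymmetric) ∧ (∀ f, ∃ p, ρ p e = f) ∧
      ∀ p, ⟪e, ρ (map Complex.ofRealHom p) e⟫_ℂ = rieszFunctional y p := by
  let core : PreInnerProductSpace.Core ℂ (MvPolynomial (Fin n) ℂ) :=
    { inner := fun f g => rieszComplex y (map (starRingEnd ℂ) f * g)
      conj_inner_symm := fun f g => by
        rw [← rieszComplex_map_conj, map_mul, map_map, mul_comm]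
        congr 2
        convert map_id _
        ext x
        simp
      re_inner_nonneg := fun f => rieszComplex_conj_mul_self_nonneg y hpsd f
      add_left := fun f g h => by rw [map_add, add_mul, map_add]
      smul_left := fun f g c => by
        rw [smul_eq_C_mul, map_mul (map _), map_C, mul_assoc, ← smul_eq_C_mul, map_smul, smul_eq_mul] }
  let instNorm : SeminormedAddCommGroup (MvPolynomial (Fin n) ℂ) :=
    InnerProductSpace.Core.toSeminormedAddCommGroup (c := core)
  let instInner : InnerProductSpace ℂ (MvPolynomial (Fin n) ℂ) := InnerProductSpace.ofCore core
  have hinner : ∀ f g : MvPolynomial (Fin n) ℂ,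
      ⟪f, g⟫_ℂ = rieszComplex y (map (starRingEnd ℂ) f * g) := fun f g => rfl
  let ρ : MvPolynomial (Fin n) ℂ →ₐ[ℂ] Module.End ℂ (MvPolynomial (Fin n) ℂ) := Algebra.lmul ℂ _
  have hρ : ∀ p f, ρ p f = p * f := fun p f => rfl
  refine ⟨MvPolynomial (Fin n) ℂ, instNorm, instInner, ρ, 1, fun i f g => ?_, fun f => ⟨f, ?_⟩,
    fun p => ?_⟩
  · rw [hinner, hinner, hρ, hρ, map_mul (map _), map_X]
    congr 1
    ring
  · rw [hρ, mul_one]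
  · rw [hinner, hρ, map_one, one_mul, mul_one, rieszComplex_map_ofReal]

theorem riesz_approximation (hpsd : ∀ p : MvPolynomial (Fin n) ℝ, 0 ≤ rieszFunctional y (p ^ 2))
    (hcarleman : ∀ i : Fin n,
      ¬ Summable (fun k : ℕ =>
        (rieszFunctional y ((X i : MvPolynomial (Fin n) ℝ) ^ (2 * (k + 1)))) ^
          (-(1 : ℝ) / (2 * (k + 1))))) :
    (∃ μ, RepresentsSeq μ y) ∧ ∀ (i : Fin n) (p : MvPolynomial (Fin n) ℝ) (ε : ℝ), 0 < ε →
      ∃ g, rieszFunctional y ((p - (1 + X i ^ 2) * g) ^ 2) < ε := by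
  obtain ⟨E, _, _, ρ, e, hsym, hcyc, hρe⟩ := exists_cyclic_representation y hpsd
  have hρ : ∀ p q g, ρ (p * q) g = ρ p (ρ q g) := fun p q g => by rw [map_mul]; rfl
  have hreal : ∀ a : MvPolynomial (Fin n) ℝ, ∀ g h,
      ⟪ρ (map Complex.ofRealHom a) g, h⟫_ℂ = ⟪g, ρ (map Complex.ofRealHom a) h⟫_ℂ := by
    intro a
    induction a using MvPolynomial.induction_on with
    | C r =>
      intro g h
      rw [map_C, ← algebraMap_eq, AlgHom.commutes, Module.algebraMap_end_apply,
        Module.algebraMap_end_apply, inner_smul_left, inner_smul_right]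
      simp
    | add p q hp hq => intro g h; simp [inner_add_left, inner_add_right, hp, hq]
    | mul_X p i hp =>
      intro g h
      rw [map_mul, map_X, hρ, hp, hsym i, ← hρ, mul_comm]
  have hinner : ∀ a b : MvPolynomial (Fin n) ℝ,
      ⟪ρ (map Complex.ofRealHom a) e, ρ (map Complex.ofRealHom b) e⟫_ℂ =
        rieszFunctional y (a * b) := fun a b => by
    rw [hreal, ← hρ, ← map_mul, hρe]
  have hnorm : ∀ a : MvPolynomial (Fin n) ℝ,
      ‖ρ (map Complex.ofRealHom a) e‖ ^ 2 = rieszFunctional y (a ^ 2) := fun a => by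
    rw [@norm_sq_eq_re_inner ℂ, hinner, pow_two]; rfl
  have hcarl : ∀ i, ¬ Summable fun k : ℕ => ‖ρ (X i ^ (k + 1)) e‖ ^ (-(1 : ℝ) / (k + 1)) := by
    intro i hs
    refine hcarleman i (hs.congr fun k => ?_)
    have h := hnorm (X i ^ (k + 1))
    rw [← pow_mul, mul_comm, map_pow, map_X] at h
    rw [← h, ← Real.rpow_natCast, ← Real.rpow_mul (norm_nonneg _)]
    congr 1
    push_cast
    field_simp
  have hdense := exists_norm_sub_lt_of_carleman ρ hsym hcyc hcarl
  constructor
  · obtain ⟨μ, hμ⟩ := exists_measure_of_dense ρ hsym (fun i j f ε hε => hdense i j f hε) e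
    refine ⟨μ, fun α => (hμ α).1, fun α => ?_⟩
    have h1 := hρe (monomial (Finsupp.equivFunOnFinite.symm α) 1)
    have h2 : map Complex.ofRealHom (monomial (Finsupp.equivFunOnFinite.symm α) 1) =
        ∏ i, (X i : MvPolynomial (Fin n) ℂ) ^ α i := by
      rw [map_monomial, map_one, monomial_eq, Finsupp.prod_fintype _ _ (by simp)]
      simp
    rw [h2] at h1
    rw [(hμ α).2, h1, Complex.ofReal_re, rieszFunctional_eq_rieszLinear, rieszLinear_monomial,
      one_mul]
    rfl
  · intro i p ε hε
    obtain ⟨g, hg⟩ := hdense i i (ρ (map Complex.ofRealHom p) e) (Real.sqrt_pos.2 hε)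
    obtain ⟨q, rfl⟩ := hcyc g
    rw [← hρ, mul_assoc] at hg
    obtain ⟨a, b, hab⟩ := exists_eq_map_add_I_mul_map ((1 + X i ^ 2) * q)
    refine ⟨a, ?_⟩
    set D : MvPolynomial (Fin n) ℝ := 1 + X i ^ 2 with hD
    have hsplit : ρ (map Complex.ofRealHom p) e - ρ ((1 + X i ^ 2) * ((1 + X i ^ 2) * q)) e =
        ρ (map Complex.ofRealHom (p - D * a)) e -
          Complex.I • ρ (map Complex.ofRealHom (D * b)) e := by
      have hCI : ∀ g, Complex.I • g = ρ (C Complex.I) g := fun g => by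
        rw [← algebraMap_eq, AlgHom.commutes]; rfl
      rw [hCI, ← hρ, ← LinearMap.sub_apply, ← map_sub, ← LinearMap.sub_apply, ← map_sub, hab]
      congr 2
      simp only [hD, map_sub, map_mul, map_add, map_one, map_pow, map_X]
      ring
    rw [← hnorm]
    rw [hsplit, Real.lt_sqrt (norm_nonneg _), @norm_sub_sq ℂ, inner_smul_right, hinner] at hg
    have h0 : RCLike.re (Complex.I * (rieszFunctional y ((p - D * a) * (D * b)) : ℂ)) = 0 := by
      simp
    rw [h0] at hg
    nlinarith [sq_nonneg ‖Complex.I • ρ (map Complex.ofRealHom (D * b)) e‖]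

end Riesz

section Uniqueness

open scoped BoundedContinuousFunction

variable {n : ℕ} {y : (Fin n → ℕ) → ℝ} {ν : Measure (Fin n → ℝ)}

theorem RepresentsSeq.integral_eval (h : RepresentsSeq ν y) (p : MvPolynomial (Fin n) ℝ) :
    Integrable (fun x => eval x p) ν ∧ ∫ x, eval x p ∂ν = rieszFunctional y p := by
  rw [rieszFunctional_eq_rieszLinear]
  induction p using MvPolynomial.induction_on' with
  | monomial α c =>
    have h1 : ∀ x : Fin n → ℝ, eval x (monomial α c) = c * ∏ i, x i ^ α i := fun x => by
      rw [eval_monomial, Finsupp.prod_fintype _ _ (by simp)]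
    simp only [h1, rieszLinear_monomial]
    exact ⟨(h.1 α).const_mul c, by rw [integral_const_mul, h.2]⟩
  | add p q hp hq =>
    simp only [map_add]
    exact ⟨hp.1.add hq.1, by rw [integral_add hp.1 hq.1, hp.2, hq.2]⟩

theorem RepresentsSeq.isFiniteMeasure (h : RepresentsSeq ν y) : IsFiniteMeasure ν := by
  have h1 := h.1 0
  simp only [Pi.zero_apply, pow_zero, Finset.prod_const_one] at h1
  exact (integrable_const_iff_isFiniteMeasure one_ne_zero).1 h1

theorem RepresentsSeq.integrable_sub_eval_sq (h : RepresentsSeq ν y) (φ : (Fin n → ℝ) →ᵇ ℝ)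
    (p : MvPolynomial (Fin n) ℝ) : Integrable (fun x => (φ x - eval x p) ^ 2) ν := by
  have := h.isFiniteMeasure
  have h1 : Integrable (fun x => (φ * φ) x) ν := (φ * φ).integrable ν
  have h2 : Integrable (fun x => φ x * eval x p) ν :=
    (h.integral_eval p).1.bdd_mul φ.continuous.aestronglyMeasurable
      (.of_forall fun x => φ.norm_coe_le_norm x)
  have h3 := (h.integral_eval (p ^ 2)).1
  refine ((h1.sub (h2.const_mul 2)).add h3).congr (.of_forall fun x => ?_)
  simp
  ring

/-- Approximability by polynomials in mean square, uniformly over the representing measures. -/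
def PolynomialApproximable (y : (Fin n → ℕ) → ℝ) (φ : (Fin n → ℝ) →ᵇ ℝ) : Prop :=
  ∀ ε : ℝ, 0 < ε → ∃ p : MvPolynomial (Fin n) ℝ, ∀ ν, RepresentsSeq ν y →
    ∫ x, (φ x - eval x p) ^ 2 ∂ν < ε

theorem PolynomialApproximable.add {φ ψ : (Fin n → ℝ) →ᵇ ℝ} (hφ : PolynomialApproximable y φ)
    (hψ : PolynomialApproximable y ψ) : PolynomialApproximable y (φ + ψ) := fun ε hε => by
  obtain ⟨p, hp⟩ := hφ (ε / 4) (by positivity)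
  obtain ⟨q, hq⟩ := hψ (ε / 4) (by positivity)
  refine ⟨p + q, fun ν hν => ?_⟩
  have h1 := hν.integrable_sub_eval_sq φ p
  have h2 := hν.integrable_sub_eval_sq ψ q
  calc ∫ x, ((φ + ψ) x - eval x (p + q)) ^ 2 ∂ν
      ≤ ∫ x, 2 * ((φ x - eval x p) ^ 2 + (ψ x - eval x q) ^ 2) ∂ν := by
        refine integral_mono (hν.integrable_sub_eval_sq _ _) ((h1.add h2).const_mul 2) fun x => ?_
        simp only [BoundedContinuousFunction.coe_add, Pi.add_apply, map_add]
        nlinarith [sq_nonneg ((φ x - eval x p) - (ψ x - eval x q))]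
    _ = 2 * (∫ x, (φ x - eval x p) ^ 2 ∂ν + ∫ x, (ψ x - eval x q) ^ 2 ∂ν) := by
        rw [integral_const_mul, integral_add h1 h2]
    _ < ε := by linarith [hp ν hν, hq ν hν]

theorem PolynomialApproximable.smul {φ : (Fin n → ℝ) →ᵇ ℝ} (hφ : PolynomialApproximable y φ)
    (r : ℝ) : PolynomialApproximable y (r • φ) := fun ε hε => by
  obtain ⟨p, hp⟩ := hφ (ε / (r ^ 2 + 1)) (by positivity)
  refine ⟨C r * p, fun ν hν => ?_⟩
  have h1 : ∀ x, ((r • φ) x - eval x (C r * p)) ^ 2 = r ^ 2 * (φ x - eval x p) ^ 2 := fun x => by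
    simp
    ring
  simp only [h1, integral_const_mul]
  have h2 := hp ν hν
  have h3 : 0 ≤ ∫ x, (φ x - eval x p) ^ 2 ∂ν := integral_nonneg fun x => sq_nonneg _
  rw [lt_div_iff₀ (by positivity)] at h2
  nlinarith

theorem PolynomialApproximable.one : PolynomialApproximable y 1 :=
  fun ε hε => ⟨1, fun ν _ => by simpa using hε⟩

theorem PolynomialApproximable.mul_of_mul_eval_eq {φ ψ : (Fin n → ℝ) →ᵇ ℝ}
    (hφ : PolynomialApproximable y φ) {d a : MvPolynomial (Fin n) ℝ}
    (hd : ∀ (p : MvPolynomial (Fin n) ℝ) (ε : ℝ), 0 < ε →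
      ∃ g, rieszFunctional y ((p - d * g) ^ 2) < ε)
    (hψ : ∀ x, ψ x * eval x d = eval x a) (hψ1 : ∀ x, |ψ x| ≤ 1) :
    PolynomialApproximable y (ψ * φ) := fun ε hε => by
  obtain ⟨p, hp⟩ := hφ (ε / 4) (by positivity)
  obtain ⟨g, hg⟩ := hd p (ε / 4) (by positivity)
  refine ⟨a * g, fun ν hν => ?_⟩
  have h1 := hν.integrable_sub_eval_sq φ p
  have h2 := hν.integral_eval ((p - d * g) ^ 2)
  calc ∫ x, ((ψ * φ) x - eval x (a * g)) ^ 2 ∂ν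
      ≤ ∫ x, 2 * ((φ x - eval x p) ^ 2 + eval x ((p - d * g) ^ 2)) ∂ν := by
        refine integral_mono (hν.integrable_sub_eval_sq _ _) ((h1.add h2.1).const_mul 2) fun x => ?_
        have h3 : ψ x ^ 2 ≤ 1 := (sq_le_one_iff_abs_le_one _).2 (hψ1 x)
        simp only [BoundedContinuousFunction.coe_mul, Pi.mul_apply, map_mul, map_pow, map_sub,
          ← hψ]
        calc (ψ x * φ x - ψ x * eval x d * eval x g) ^ 2
            = ψ x ^ 2 * ((φ x - eval x p) + (eval x p - eval x d * eval x g)) ^ 2 := by ring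
          _ ≤ 1 * ((φ x - eval x p) + (eval x p - eval x d * eval x g)) ^ 2 := by gcongr
          _ ≤ _ := by
            nlinarith [sq_nonneg ((φ x - eval x p) - (eval x p - eval x d * eval x g))]
    _ = 2 * (∫ x, (φ x - eval x p) ^ 2 ∂ν + rieszFunctional y ((p - d * g) ^ 2)) := by
        rw [integral_const_mul, integral_add h1 h2.1, h2.2]
    _ < ε := by linarith [hp ν hν]

theorem PolynomialApproximable.integral_eq {φ : (Fin n → ℝ) →ᵇ ℝ}
    (hφ : PolynomialApproximable y φ) {μ : Measure (Fin n → ℝ)} (hμ : RepresentsSeq μ y)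
    (hν : RepresentsSeq ν y) : ∫ x, φ x ∂μ = ∫ x, φ x ∂ν := by
  have key : ∀ δ : ℝ, 0 < δ → ∃ c : ℝ, ∀ σ, RepresentsSeq σ y →
      |∫ x, φ x ∂σ - c| ≤ δ * (σ.real Set.univ + 1) := fun δ hδ => by
    obtain ⟨p, hp⟩ := hφ (δ ^ 2) (by positivity)
    refine ⟨rieszFunctional y p, fun σ hσ => ?_⟩
    have := hσ.isFiniteMeasure
    have h1 := hσ.integrable_sub_eval_sq φ p
    have h2 := hσ.integral_eval p
    rw [← h2.2, ← integral_sub (φ.integrable σ) h2.1]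
    calc |∫ x, (φ x - eval x p) ∂σ| ≤ ∫ x, |φ x - eval x p| ∂σ := abs_integral_le_integral_abs
      _ ≤ ∫ x, (δ + δ⁻¹ * (φ x - eval x p) ^ 2) ∂σ := by
        refine integral_mono ((φ.integrable σ).sub h2.1).abs
          ((integrable_const _).add (h1.const_mul _)) fun x => ?_
        have h3 : δ⁻¹ * (φ x - eval x p) ^ 2 = |φ x - eval x p| ^ 2 / δ := by
          rw [sq_abs]; field_simp
        simp only [h3]
        rw [← sub_le_iff_le_add', le_div_iff₀ hδ]
        nlinarith [sq_nonneg (|φ x - eval x p| - δ), abs_nonneg (φ x - eval x p)]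
      _ = δ * σ.real Set.univ + δ⁻¹ * ∫ x, (φ x - eval x p) ^ 2 ∂σ := by
        rw [integral_add (integrable_const _) (h1.const_mul _), integral_const_mul,
          integral_const, smul_eq_mul, mul_comm]
      _ ≤ δ * σ.real Set.univ + δ⁻¹ * δ ^ 2 := by gcongr; exact (hp σ hσ).le
      _ = δ * (σ.real Set.univ + 1) := by field_simp
  refine eq_of_abs_sub_le_all fun ε hε => ?_
  set K := (μ.real Set.univ + 1) + (ν.real Set.univ + 1) with hK
  have hK0 : 0 < K := by positivity
  obtain ⟨c, hc⟩ := key (ε / K) (by positivity)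
  calc |∫ x, φ x ∂μ - ∫ x, φ x ∂ν| ≤ |∫ x, φ x ∂μ - c| + |∫ x, φ x ∂ν - c| := by
        rw [abs_sub_comm (∫ x, φ x ∂ν)]; exact abs_sub_le _ _ _
    _ ≤ ε / K * (μ.real Set.univ + 1) + ε / K * (ν.real Set.univ + 1) :=
      add_le_add (hc μ hμ) (hc ν hν)
    _ = ε := by rw [← mul_add, ← hK]; field_simp

/-- Bounded continuous functions whose multiplication preserves polynomial approximability. -/
noncomputable def approximableMultipliers (y : (Fin n → ℕ) → ℝ) :
    StarSubalgebra ℝ ((Fin n → ℝ) →ᵇ ℝ) where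
  carrier := {ψ | ∀ φ, PolynomialApproximable y φ → PolynomialApproximable y (ψ * φ)}
  mul_mem' := fun hψ hψ' φ hφ => by rw [mul_assoc]; exact hψ _ (hψ' φ hφ)
  add_mem' := fun hψ hψ' φ hφ => by rw [add_mul]; exact (hψ φ hφ).add (hψ' φ hφ)
  algebraMap_mem' := fun r φ hφ => by rw [← Algebra.smul_def]; exact hφ.smul r
  star_mem' := fun {ψ} hψ => by
    have : star ψ = ψ := by ext x; simp
    rwa [this]

theorem abs_inv_one_add_sq_le (t : ℝ) : |(1 + t ^ 2)⁻¹| ≤ 1 := by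
  rw [abs_of_pos (by positivity)]
  exact inv_le_one_of_one_le₀ (by nlinarith [sq_nonneg t])

theorem abs_mul_inv_one_add_sq_le (t : ℝ) : |t * (1 + t ^ 2)⁻¹| ≤ 1 := by
  rw [abs_mul, abs_of_pos (a := (1 + t ^ 2)⁻¹) (by positivity), ← div_eq_mul_inv,
    div_le_one (by positivity)]
  nlinarith [sq_nonneg (|t| - 1), sq_abs t]

theorem RepresentsSeq.eq_of_dense
    (hdense : ∀ (i : Fin n) (p : MvPolynomial (Fin n) ℝ) (ε : ℝ), 0 < ε →
      ∃ g, rieszFunctional y ((p - (1 + X i ^ 2) * g) ^ 2) < ε)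
    {μ : Measure (Fin n → ℝ)} (hμ : RepresentsSeq μ y) (hν : RepresentsSeq ν y) : ν = μ := by
  have := hμ.isFiniteMeasure
  have := hν.isFiniteMeasure
  have hpos : ∀ t : ℝ, 1 + t ^ 2 ≠ 0 := fun t => by positivity
  let b : Fin n → (Fin n → ℝ) →ᵇ ℝ := fun i =>
    .ofNormedAddCommGroup (fun x => (1 + x i ^ 2)⁻¹)
      (by fun_prop (disch := exact fun x => hpos _)) 1 fun x => abs_inv_one_add_sq_le (x i)
  let c : Fin n → (Fin n → ℝ) →ᵇ ℝ := fun i =>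
    .ofNormedAddCommGroup (fun x => x i * (1 + x i ^ 2)⁻¹)
      (by fun_prop (disch := exact fun x => hpos _)) 1 fun x => abs_mul_inv_one_add_sq_le (x i)
  have hb : ∀ i, b i ∈ approximableMultipliers y := fun i φ hφ =>
    hφ.mul_of_mul_eval_eq (hdense i) (a := 1) (fun x => by simp [b, hpos])
      fun x => abs_inv_one_add_sq_le (x i)
  have hc : ∀ i, c i ∈ approximableMultipliers y := fun i φ hφ =>
    hφ.mul_of_mul_eval_eq (hdense i) (a := X i) (fun x => by simp [c, hpos])
      fun x => abs_mul_inv_one_add_sq_le (x i)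
  refine ext_of_forall_mem_subalgebra_integral_eq_of_pseudoEMetric_complete_countable
    (𝕜 := ℝ) (A := approximableMultipliers y) (fun x z hxz => ?_) fun ψ hψ => ?_
  · obtain ⟨i, hi⟩ := Function.ne_iff.1 hxz
    by_cases h : b i x = b i z
    · refine ⟨_, ⟨_, ⟨c i, hc i, rfl⟩, rfl⟩, fun h' => hi ?_⟩
      have h1 : (1 + x i ^ 2)⁻¹ = (1 + z i ^ 2)⁻¹ := h
      have h2 : x i * (1 + x i ^ 2)⁻¹ = z i * (1 + z i ^ 2)⁻¹ := h'
      rw [h1] at h2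
      exact mul_right_cancel₀ (inv_ne_zero (hpos _)) h2
    · exact ⟨_, ⟨_, ⟨b i, hb i, rfl⟩, rfl⟩, h⟩
  · have := hψ 1 .one
    rw [mul_one] at this
    exact this.integral_eq hν hμ

end Uniqueness

/-- If all moment matrices of `y` are positive semidefinite (equivalently the Riesz
functional is nonnegative on squares) and the multivariate Carleman condition
`∑_k L_y(x_i^{2k})^{-1/(2k)} = +∞` holds for every coordinate `i`, then `y` has a
representing measure, and that measure is unique (moment determinacy). -/
theorem carleman_representing_measure {n : ℕ} (y : (Fin n → ℕ) → ℝ)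
    (hpsd : ∀ p : MvPolynomial (Fin n) ℝ, 0 ≤ rieszFunctional y (p ^ 2))
    (hcarleman : ∀ i : Fin n,
      ¬ Summable (fun k : ℕ =>
        (rieszFunctional y ((X i : MvPolynomial (Fin n) ℝ) ^ (2 * (k + 1)))) ^
          (-(1 : ℝ) / (2 * (k + 1))))) :
    ∃ μ : Measure (Fin n → ℝ),
      RepresentsSeq μ y ∧ ∀ ν : Measure (Fin n → ℝ), RepresentsSeq ν y → ν = μ := by
  obtain ⟨⟨μ, hμ⟩, hdense⟩ := riesz_approximation y hpsd hcarleman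
  exact ⟨μ, hμ, fun ν hν => hμ.eq_of_dense hdense hν⟩
end

section
/- Let X ⊂ ℝⁿ be compact, Ω ⊂ ℝᵖ, A ⊂ ℝᵗ compact. Let ν be a probability measure on X × Ω and ψ a probability measure on X × A with x-marginal λ. Suppose ∫ x^α ω^β dν(x,ω) = ∫ x^α p_β(a) dψ(x,a) for all α ∈ ℕⁿ, β ∈ ℕᵖ, where p_β ∈ ℝ[a] satisfies ∫_Ω ω^β dμ_a(ω) = p_β(a) for all a ∈ A, and suppose every mixture of (μ_a) is moment determinate. Then ν = T*ψ, i.e. ν(B×D) = ∫_{B×A} μ_a(D) dψ(x,a) for all Borel B ⊂ X, D ⊂ Ω. -/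
open MeasureTheory MvPolynomial

/-- `μ` is a mixture of the family `(μ_a)_{a ∈ A}`. -/
def IsMixture {p t : ℕ} (A : Set (Fin t → ℝ))
    (μa : (Fin t → ℝ) → Measure (Fin p → ℝ)) (μ : Measure (Fin p → ℝ)) : Prop :=
  ∃ φ : Measure (Fin t → ℝ), IsProbabilityMeasure φ ∧ φ Aᶜ = 0 ∧
    ∀ B : Set (Fin p → ℝ), MeasurableSet B → μ B = ∫⁻ a, μa a B ∂φ

theorem integrable_continuous_comp_mul_of_ae_mem_isCompact {Y Z : Type*} [TopologicalSpace Y]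
    [T2Space Y] [MeasurableSpace Y] [BorelSpace Y] [MeasurableSpace Z] {m : Measure Z} {K : Set Y}
    (hK : IsCompact K) {π : Z → Y} (hπ : Measurable π) (hπK : ∀ᵐ z ∂m, π z ∈ K)
    {f : Z → ℝ} (hf : Integrable f m) {h : Y → ℝ} (hh : Continuous h) :
    Integrable (fun z => h (π z) * f z) m := by
  obtain ⟨C, hC⟩ := hK.exists_bound_of_continuousOn hh.continuousOn
  exact hf.bdd_mul (c := C) (hh.measurable.comp hπ).aestronglyMeasurable
    (hπK.mono fun z hz => hC _ hz)

section WeightedMoments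

variable {n : ℕ} {Z₁ Z₂ : Type*} [MeasurableSpace Z₁] [MeasurableSpace Z₂]
  {m₁ : Measure Z₁} {m₂ : Measure Z₂} {K : Set (Fin n → ℝ)}
  {π₁ : Z₁ → Fin n → ℝ} {π₂ : Z₂ → Fin n → ℝ} {f₁ : Z₁ → ℝ} {f₂ : Z₂ → ℝ}

theorem integral_eval_mul_eq_sum {Z : Type*} [MeasurableSpace Z] {m : Measure Z}
    (hK : IsCompact K) {π : Z → Fin n → ℝ} (hπ : Measurable π) (hπK : ∀ᵐ z ∂m, π z ∈ K)
    {f : Z → ℝ} (hf : Integrable f m) (P : MvPolynomial (Fin n) ℝ) :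
    ∫ z, MvPolynomial.eval (π z) P * f z ∂m =
      ∑ d ∈ P.support, MvPolynomial.coeff d P * ∫ z, (∏ i, π z i ^ d i) * f z ∂m := by
  simp_rw [MvPolynomial.eval_eq', Finset.sum_mul, mul_assoc]
  rw [integral_finsetSum]
  · simp_rw [integral_const_mul]
  · intro d _
    exact (integrable_continuous_comp_mul_of_ae_mem_isCompact hK hπ hπK hf
      (h := fun x => ∏ i, x i ^ d i) (by fun_prop)).const_mul _

theorem exists_mvPolynomial_near_on_isCompact (hK : IsCompact K) {h : (Fin n → ℝ) → ℝ}
    (hh : Continuous h) {ε : ℝ} (hε : 0 < ε) :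
    ∃ P : MvPolynomial (Fin n) ℝ, ∀ x ∈ K, |MvPolynomial.eval x P - h x| < ε := by
  have := isCompact_iff_compactSpace.mp hK
  let coord : Fin n → C(K, ℝ) := fun i => ⟨fun x => x.1 i, (continuous_apply i).comp continuous_subtype_val⟩
  have hsep : (MvPolynomial.aeval (R := ℝ) coord).range.SeparatesPoints := by
    intro x y hxy
    obtain ⟨i, hi⟩ := Function.ne_iff.mp (Subtype.coe_ne_coe.mpr hxy)
    exact ⟨coord i, ⟨coord i, ⟨MvPolynomial.X i, by simp⟩, rfl⟩, hi⟩
  obtain ⟨⟨g, P, rfl⟩, hg⟩ :=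
    ContinuousMap.exists_mem_subalgebra_near_continuous_of_separatesPoints _ hsep
      (fun x : K => h x) (by fun_prop) ε hε
  refine ⟨P, fun x hx => ?_⟩
  have key : (MvPolynomial.aeval (R := ℝ) coord P) ⟨x, hx⟩ = MvPolynomial.eval x P := by
    have : ((ContinuousMap.evalAlgHom ℝ ℝ (⟨x, hx⟩ : K)).comp
        (MvPolynomial.aeval (R := ℝ) coord)) = MvPolynomial.aeval x := by
      ext i
      simp [coord]
    simpa using DFunLike.congr_fun this P
  simpa [key, Real.norm_eq_abs] using hg ⟨x, hx⟩

theorem abs_integral_sub_le_of_near {Y Z : Type*} [TopologicalSpace Y]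
    [T2Space Y] [MeasurableSpace Y] [BorelSpace Y] [MeasurableSpace Z] {m : Measure Z} {K : Set Y}
    (hK : IsCompact K) {π : Z → Y} (hπ : Measurable π) (hπK : ∀ᵐ z ∂m, π z ∈ K)
    {f : Z → ℝ} (hf : Integrable f m) {g h : Y → ℝ} (hg : Continuous g) (hh : Continuous h)
    {ε : ℝ} (hgh : ∀ x ∈ K, |g x - h x| < ε) :
    |(∫ z, g (π z) * f z ∂m) - ∫ z, h (π z) * f z ∂m| ≤ ε * ∫ z, ‖f z‖ ∂m := by
  rw [← integral_sub (integrable_continuous_comp_mul_of_ae_mem_isCompact hK hπ hπK hf hg)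
    (integrable_continuous_comp_mul_of_ae_mem_isCompact hK hπ hπK hf hh), ← integral_const_mul,
    ← Real.norm_eq_abs]
  refine norm_integral_le_of_norm_le (hf.norm.const_mul ε) (hπK.mono fun z hz => ?_)
  rw [← sub_mul, norm_mul]
  gcongr
  exact (hgh _ hz).le

theorem integral_continuous_comp_mul_eq_of_moments_eq (hK : IsCompact K)
    (hπ₁ : Measurable π₁) (hπK₁ : ∀ᵐ z ∂m₁, π₁ z ∈ K)
    (hπ₂ : Measurable π₂) (hπK₂ : ∀ᵐ z ∂m₂, π₂ z ∈ K)
    (hf₁ : Integrable f₁ m₁) (hf₂ : Integrable f₂ m₂)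
    (hmom : ∀ α : Fin n → ℕ, ∫ z, (∏ i, π₁ z i ^ α i) * f₁ z ∂m₁ =
      ∫ z, (∏ i, π₂ z i ^ α i) * f₂ z ∂m₂)
    {h : (Fin n → ℝ) → ℝ} (hh : Continuous h) :
    ∫ z, h (π₁ z) * f₁ z ∂m₁ = ∫ z, h (π₂ z) * f₂ z ∂m₂ := by
  set M : ℝ := (∫ z, ‖f₁ z‖ ∂m₁) + ∫ z, ‖f₂ z‖ ∂m₂
  have hM : 0 ≤ M := by positivity
  refine eq_of_abs_sub_le_all fun δ hδ => ?_
  obtain ⟨P, hP⟩ := exists_mvPolynomial_near_on_isCompact hK hh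
    (show 0 < δ / (M + 1) by positivity)
  have hPc : Continuous fun x => MvPolynomial.eval x P := MvPolynomial.continuous_eval P
  have h₁ := abs_integral_sub_le_of_near hK hπ₁ hπK₁ hf₁ hPc hh hP
  have h₂ := abs_integral_sub_le_of_near hK hπ₂ hπK₂ hf₂ hPc hh hP
  rw [integral_eval_mul_eq_sum hK hπ₁ hπK₁ hf₁] at h₁
  rw [integral_eval_mul_eq_sum hK hπ₂ hπK₂ hf₂] at h₂
  simp_rw [hmom] at h₁
  have h₃ : δ / (M + 1) * M ≤ δ := by
    rw [div_mul_eq_mul_div, div_le_iff₀ (by positivity)]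
    nlinarith
  have h₄ : δ / (M + 1) * M = δ / (M + 1) * (∫ z, ‖f₁ z‖ ∂m₁) +
    δ / (M + 1) * ∫ z, ‖f₂ z‖ ∂m₂ := mul_add _ _ _
  rw [abs_le] at h₁ h₂ ⊢
  constructor <;> linarith

theorem tendsto_integral_apprSeq_comp_mul {Z : Type*} [MeasurableSpace Z] {m : Measure Z}
    {π : Z → Fin n → ℝ} (hπ : Measurable π) {f : Z → ℝ} (hf : Integrable f m)
    {F : Set (Fin n → ℝ)} (hF : IsClosed F) :
    Filter.Tendsto (fun k => ∫ z, (hF.apprSeq k (π z) : ℝ) * f z ∂m) Filter.atTop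
      (nhds (∫ z in π ⁻¹' F, f z ∂m)) := by
  rw [← integral_indicator (hπ hF.measurableSet)]
  have hc (k : ℕ) : Continuous fun x => (hF.apprSeq k x : ℝ) :=
    NNReal.continuous_coe.comp (hF.apprSeq k).continuous
  refine tendsto_integral_of_dominated_convergence (fun z => ‖f z‖)
    (fun k => ((hc k).measurable.comp hπ).aestronglyMeasurable.mul hf.1) hf.norm
    (fun k => .of_forall fun z => ?_) (.of_forall fun z => ?_)
  · rw [norm_mul]
    refine mul_le_of_le_one_left (norm_nonneg _) ?_
    simpa using HasOuterApproxClosed.apprSeq_apply_le_one hF k (π z)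
  · have hlim := tendsto_pi_nhds.mp (HasOuterApproxClosed.tendsto_apprSeq hF) (π z)
    have hlim' := ((NNReal.continuous_coe.tendsto _).comp hlim).mul_const (f z)
    have hind : (π ⁻¹' F).indicator f z = (F.indicator (fun _ => 1) (π z) : NNReal) * f z := by
      by_cases hz : π z ∈ F <;> simp [Set.indicator, hz]
    rw [hind]
    exact hlim'

theorem setIntegral_preimage_eq_of_moments_eq (hK : IsCompact K)
    (hπ₁ : Measurable π₁) (hπK₁ : ∀ᵐ z ∂m₁, π₁ z ∈ K)
    (hπ₂ : Measurable π₂) (hπK₂ : ∀ᵐ z ∂m₂, π₂ z ∈ K)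
    (hf₁ : Integrable f₁ m₁) (hf₂ : Integrable f₂ m₂)
    (hmom : ∀ α : Fin n → ℕ, ∫ z, (∏ i, π₁ z i ^ α i) * f₁ z ∂m₁ =
      ∫ z, (∏ i, π₂ z i ^ α i) * f₂ z ∂m₂)
    {B : Set (Fin n → ℝ)} (hB : MeasurableSet B) :
    ∫ z in π₁ ⁻¹' B, f₁ z ∂m₁ = ∫ z in π₂ ⁻¹' B, f₂ z ∂m₂ := by
  have hgen : (MeasurableSpace.pi : MeasurableSpace (Fin n → ℝ)) =
      MeasurableSpace.generateFrom {F | IsClosed F} :=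
    BorelSpace.measurable_eq.trans borel_eq_generateFrom_isClosed
  induction B, hB using MeasurableSpace.induction_on_inter hgen isPiSystem_isClosed with
  | empty => simp
  | basic F hF =>
    have hF : IsClosed F := hF
    refine tendsto_nhds_unique (tendsto_integral_apprSeq_comp_mul hπ₁ hf₁ hF) ?_
    refine (tendsto_integral_apprSeq_comp_mul hπ₂ hf₂ hF).congr fun k => ?_
    exact (integral_continuous_comp_mul_eq_of_moments_eq hK hπ₁ hπK₁ hπ₂ hπK₂ hf₁ hf₂ hmom
      (NNReal.continuous_coe.comp (hF.apprSeq k).continuous)).symm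
  | compl B hB ih =>
    have h₁ := integral_add_compl (hπ₁ hB) hf₁
    have h₂ := integral_add_compl (hπ₂ hB) hf₂
    have h₀ : ∫ z, f₁ z ∂m₁ = ∫ z, f₂ z ∂m₂ := by simpa using hmom 0
    rw [Set.preimage_compl, Set.preimage_compl]
    linarith
  | iUnion B hd hB ih =>
    rw [Set.preimage_iUnion, Set.preimage_iUnion]
    have h₁ := integral_iUnion (fun i => hπ₁ (hB i))
      (fun i j hij => (hd hij).preimage π₁) hf₁.integrableOn
    have h₂ := integral_iUnion (fun i => hπ₂ (hB i))
      (fun i j hij => (hd hij).preimage π₂) hf₂.integrableOn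
    rw [h₁, h₂]
    simp_rw [ih]

end WeightedMoments

theorem ae_abs_lt_of_even_moments_le {Z : Type*} [MeasurableSpace Z] {m : Measure Z}
    [IsFiniteMeasure m] {g : Z → ℝ} {R r : ℝ} (hR : 0 ≤ R) (hr : R < r)
    (hint : ∀ k : ℕ, Integrable (fun z => g z ^ (2 * k)) m)
    (hle : ∀ k : ℕ, ∫ z, g z ^ (2 * k) ∂m ≤ R ^ (2 * k)) :
    ∀ᵐ z ∂m, |g z| < r := by
  have hr₀ : 0 < r := hR.trans_lt hr
  have hbound (k : ℕ) : m.real {z | r ≤ |g z|} ≤ ((R / r) ^ 2) ^ k := by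
    have hmarkov := mul_meas_ge_le_integral_of_nonneg
      (.of_forall fun z => (even_two_mul k).pow_nonneg (g z)) (hint k) (r ^ (2 * k))
    have hsub : m.real {z | r ≤ |g z|} ≤ m.real {z | r ^ (2 * k) ≤ g z ^ (2 * k)} := by
      refine measureReal_mono fun z hz => ?_
      have := pow_le_pow_left₀ hr₀.le (show r ≤ |g z| from hz) (2 * k)
      rwa [(even_two_mul k).pow_abs] at this
    rw [← pow_mul, div_pow, le_div_iff₀ (by positivity), mul_comm]
    calc _ ≤ r ^ (2 * k) * m.real {z | r ^ (2 * k) ≤ g z ^ (2 * k)} := by gcongr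
      _ ≤ _ := hmarkov.trans (hle k)
  have hlim : Filter.Tendsto (fun k : ℕ => ((R / r) ^ 2) ^ k) Filter.atTop (nhds 0) := by
    refine tendsto_pow_atTop_nhds_zero_of_lt_one (by positivity) ?_
    have : R / r < 1 := (div_lt_one hr₀).mpr hr
    exact pow_lt_one₀ (by positivity) this two_ne_zero
  have hzero : m.real {z | r ≤ |g z|} = 0 :=
    le_antisymm (ge_of_tendsto' hlim hbound) measureReal_nonneg
  rw [measureReal_eq_zero_iff] at hzero
  rw [ae_iff]
  simpa using hzero

theorem norm_prod_pow_le_one_add {p : ℕ} (ω : Fin p → ℝ) (β : Fin p → ℕ) :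
    ‖∏ i, ω i ^ β i‖ ≤ 1 + ∏ i, ω i ^ (2 * β) i := by
  have : ∏ i, ω i ^ (2 * β) i = ‖∏ i, ω i ^ β i‖ ^ 2 := by
    rw [Real.norm_eq_abs, sq_abs, ← Finset.prod_pow]
    refine Finset.prod_congr rfl fun i _ => ?_
    simp [← pow_mul, mul_comm]
  rw [this]
  nlinarith [sq_nonneg (‖∏ i, ω i ^ β i‖ - 1)]

section Mixtures

open ProbabilityTheory

variable {p t : ℕ} {A : Set (Fin t → ℝ)} {κ : Kernel (Fin t → ℝ) (Fin p → ℝ)}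
  {F : (Fin p → ℕ) → (Fin t → ℝ) → ℝ} {φ : Measure (Fin t → ℝ)}

theorem integrable_monomial_comp [IsMarkovKernel κ] [IsFiniteMeasure φ] (hφ : ∀ᵐ a ∂φ, a ∈ A)
    (hint : ∀ a ∈ A, ∀ β : Fin p → ℕ, Integrable (fun ω => ∏ i, ω i ^ β i) (κ a))
    (hmom : ∀ a ∈ A, ∀ β : Fin p → ℕ, ∫ ω, (∏ i, ω i ^ β i) ∂(κ a) = F β a)
    (hF : ∀ β, Integrable (F β) φ) (β : Fin p → ℕ) :
    Integrable (fun ω => ∏ i, ω i ^ β i) (κ ∘ₘ φ) := by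
  have hc : Continuous fun ω : Fin p → ℝ => ∏ i, ω i ^ β i := by fun_prop
  rw [Measure.integrable_comp_iff hc.aestronglyMeasurable]
  refine ⟨hφ.mono fun a ha => hint a ha β, ?_⟩
  refine ((integrable_const 1).add (hF (2 * β))).mono'
    hc.norm.stronglyMeasurable.integral_kernel.aestronglyMeasurable (hφ.mono fun a ha => ?_)
  rw [Real.norm_of_nonneg (by positivity), Pi.add_apply, ← hmom a ha (2 * β)]
  calc _ ≤ ∫ ω, (1 + ∏ i, ω i ^ (2 * β) i) ∂(κ a) :=
        integral_mono (hint a ha β).norm ((integrable_const 1).add (hint a ha _))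
          fun ω => norm_prod_pow_le_one_add ω β
    _ = _ := by
      rw [integral_add (integrable_const 1) (hint a ha _)]
      simp

theorem integral_monomial_comp [IsMarkovKernel κ] [IsFiniteMeasure φ] (hφ : ∀ᵐ a ∂φ, a ∈ A)
    (hint : ∀ a ∈ A, ∀ β : Fin p → ℕ, Integrable (fun ω => ∏ i, ω i ^ β i) (κ a))
    (hmom : ∀ a ∈ A, ∀ β : Fin p → ℕ, ∫ ω, (∏ i, ω i ^ β i) ∂(κ a) = F β a)
    (hF : ∀ β, Integrable (F β) φ) (β : Fin p → ℕ) :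
    ∫ ω, (∏ i, ω i ^ β i) ∂(κ ∘ₘ φ) = ∫ a, F β a ∂φ := by
  have h := integrable_monomial_comp hφ hint hmom hF β
  rw [Measure.comp_eq_comp_const_apply] at h ⊢
  rw [Kernel.integral_comp h, Kernel.const_apply]
  exact integral_congr_ae (hφ.mono fun a ha => hmom a ha β)

/-- A measurable family that consists of probability measures on `A`, as a Markov kernel that
agrees with the family on `A`. -/
theorem exists_isMarkovKernel_eqOn (hA : MeasurableSet A)
    {μa : (Fin t → ℝ) → Measure (Fin p → ℝ)} (hprob : ∀ a ∈ A, IsProbabilityMeasure (μa a))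
    (hmeas : ∀ B : Set (Fin p → ℝ), MeasurableSet B → Measurable fun a => μa a B) :
    ∃ κ : Kernel (Fin t → ℝ) (Fin p → ℝ), IsMarkovKernel κ ∧ ∀ a ∈ A, κ a = μa a := by
  classical
  let κ₀ : Kernel (Fin t → ℝ) (Fin p → ℝ) := ⟨μa, Measure.measurable_of_measurable_coe _ hmeas⟩
  refine ⟨Kernel.piecewise hA κ₀ (Kernel.const _ (Measure.dirac 0)), ⟨fun a => ?_⟩,
    fun a ha => ?_⟩
  · rw [Kernel.piecewise_apply]
    split_ifs with ha
    · exact hprob a ha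
    · rw [Kernel.const_apply]
      infer_instance
  · rw [Kernel.piecewise_apply, if_pos ha]
    rfl

end Mixtures

section Marginals

variable {n : ℕ} {Z₁ Z₂ : Type*} [MeasurableSpace Z₁] [MeasurableSpace Z₂]
  {m₁ : Measure Z₁} {m₂ : Measure Z₂} {π₁ : Z₁ → Fin n → ℝ} {π₂ : Z₂ → Fin n → ℝ}

/-- Equality of moments transfers compactness of the support. -/
theorem exists_isCompact_ae_mem_of_moments_eq [IsProbabilityMeasure m₁] [IsProbabilityMeasure m₂]
    {K : Set (Fin n → ℝ)} (hK : IsCompact K) (hπK : ∀ᵐ z ∂m₂, π₂ z ∈ K)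
    (hint : ∀ α : Fin n → ℕ, Integrable (fun z => ∏ i, π₁ z i ^ α i) m₁)
    (hmom : ∀ α : Fin n → ℕ, ∫ z, (∏ i, π₁ z i ^ α i) ∂m₁ = ∫ z, (∏ i, π₂ z i ^ α i) ∂m₂) :
    ∃ K' : Set (Fin n → ℝ), IsCompact K' ∧ (∀ᵐ z ∂m₁, π₁ z ∈ K') ∧ ∀ᵐ z ∂m₂, π₂ z ∈ K' := by
  obtain ⟨R, hR, hKR⟩ := hK.isBounded.exists_pos_norm_le
  have hsingle (x : Fin n → ℝ) (i : Fin n) (k : ℕ) :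
      ∏ j, x j ^ (Pi.single i k : Fin n → ℕ) j = x i ^ k := by
    rw [Finset.prod_eq_single i]
    · simp
    · intro j _ hj
      simp [hj]
    · simp
  refine ⟨Metric.closedBall 0 (R + 1), isCompact_closedBall _ _, ?_, ?_⟩
  · have hcoord (i : Fin n) : ∀ᵐ z ∂m₁, |π₁ z i| < R + 1 := by
      refine ae_abs_lt_of_even_moments_le hR.le (lt_add_one R) (fun k => ?_) fun k => ?_
      · simpa [hsingle] using hint (Pi.single i (2 * k))
      · have h := hmom (Pi.single i (2 * k))
        simp_rw [hsingle] at h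
        rw [h]
        have hle : ∀ᵐ z ∂m₂, ‖π₂ z i ^ (2 * k)‖ ≤ R ^ (2 * k) := hπK.mono fun z hz => by
          rw [norm_pow]
          exact pow_le_pow_left₀ (norm_nonneg _) ((norm_le_pi_norm _ i).trans (hKR _ hz)) _
        simpa using (le_abs_self _).trans (norm_integral_le_of_norm_le_const hle)
    filter_upwards [ae_all_iff.mpr hcoord] with z hz
    rw [mem_closedBall_zero_iff, pi_norm_le_iff_of_nonneg (by positivity)]
    exact fun i => (hz i).le
  · filter_upwards [hπK] with z hz
    rw [mem_closedBall_zero_iff]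
    exact (hKR _ hz).trans (by linarith)

end Marginals

open ProbabilityTheory in
theorem integral_map_snd_cond {X Y : Type*} [MeasurableSpace X] [MeasurableSpace Y]
    {m : Measure (X × Y)} (B : Set X) {f : Y → ℝ} (hf : StronglyMeasurable f) :
    ∫ y, f y ∂(m[|Prod.fst ⁻¹' B]).map Prod.snd =
      (m (Prod.fst ⁻¹' B))⁻¹.toReal * ∫ z in Prod.fst ⁻¹' B, f z.2 ∂m := by
  rw [integral_map measurable_snd.aemeasurable hf.aestronglyMeasurable, ProbabilityTheory.cond,
    integral_smul_measure, smul_eq_mul]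

open ProbabilityTheory in
/-- If `ν` is a probability measure on `X × Ω` and `ψ` a probability measure on
`X × A` with `x`-marginal `λ` such that
`∫ x^α ω^β dν = ∫ x^α p_β(a) dψ` for all `α, β` (where `p_β(a) = ∫ ω^β dμ_a`),
and if every mixture of `(μ_a)` is moment determinate, then `ν = T*ψ`. -/
theorem moment_matching_implies_Tstar {n p t : ℕ}
    (X : Set (Fin n → ℝ)) (hX : IsCompact X)
    (A : Set (Fin t → ℝ)) (hA : IsCompact A)
    (μa : (Fin t → ℝ) → Measure (Fin p → ℝ))
    (hprob : ∀ a ∈ A, IsProbabilityMeasure (μa a))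
    (hmeas : ∀ B : Set (Fin p → ℝ), MeasurableSet B → Measurable fun a => μa a B)
    (pβ : (Fin p → ℕ) → MvPolynomial (Fin t) ℝ)
    (hintβ : ∀ a ∈ A, ∀ β : Fin p → ℕ,
      Integrable (fun ω : Fin p → ℝ => ∏ i, ω i ^ β i) (μa a))
    (hpβ : ∀ a ∈ A, ∀ β : Fin p → ℕ,
      (∫ ω, (∏ i, ω i ^ β i) ∂(μa a)) = MvPolynomial.eval a (pβ β))
    (lam : Measure (Fin n → ℝ)) [IsProbabilityMeasure lam] (hlamX : lam Xᶜ = 0)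
    (ν : Measure ((Fin n → ℝ) × (Fin p → ℝ))) [IsProbabilityMeasure ν]
    (ψ : Measure ((Fin n → ℝ) × (Fin t → ℝ))) [IsProbabilityMeasure ψ]
    (hψsupp : ψ (X ×ˢ A)ᶜ = 0)
    (hψmarg : ψ.map Prod.fst = lam)
    (hνint : ∀ (α : Fin n → ℕ) (β : Fin p → ℕ),
      Integrable (fun q : (Fin n → ℝ) × (Fin p → ℝ) =>
        (∏ i, q.1 i ^ α i) * ∏ i, q.2 i ^ β i) ν)
    (hψint : ∀ (α : Fin n → ℕ) (β : Fin p → ℕ),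
      Integrable (fun q : (Fin n → ℝ) × (Fin t → ℝ) =>
        (∏ i, q.1 i ^ α i) * MvPolynomial.eval q.2 (pβ β)) ψ)
    (hmoments : ∀ (α : Fin n → ℕ) (β : Fin p → ℕ),
      (∫ q, ((∏ i, q.1 i ^ α i) * ∏ i, q.2 i ^ β i) ∂ν) =
      ∫ q, ((∏ i, q.1 i ^ α i) * MvPolynomial.eval q.2 (pβ β)) ∂ψ)
    (hdet : ∀ μ : Measure (Fin p → ℝ), IsMixture A μa μ →
      ∀ μ' : Measure (Fin p → ℝ), IsFiniteMeasure μ' →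
        (∀ β : Fin p → ℕ, Integrable (fun ω : Fin p → ℝ => ∏ i, ω i ^ β i) μ') →
        (∀ β : Fin p → ℕ,
          (∫ ω, (∏ i, ω i ^ β i) ∂μ') = ∫ ω, (∏ i, ω i ^ β i) ∂μ) →
        μ' = μ) :
    ∀ s : Set ((Fin n → ℝ) × (Fin p → ℝ)), MeasurableSet s →
      ν s = ∫⁻ q, μa q.2 {ω | (q.1, ω) ∈ s} ∂ψ := by
  have hAm := hA.measurableSet
  have hψX : ∀ᵐ q ∂ψ, q.1 ∈ X :=
    (show ∀ᵐ q ∂ψ, q ∈ X ×ˢ A from hψsupp).mono fun q hq => hq.1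
  have hψA : ∀ᵐ q ∂ψ, q.2 ∈ A :=
    (show ∀ᵐ q ∂ψ, q ∈ X ×ˢ A from hψsupp).mono fun q hq => hq.2
  obtain ⟨κ, hκ, hκA⟩ := exists_isMarkovKernel_eqOn hAm hprob hmeas
  have hintκ : ∀ a ∈ A, ∀ β : Fin p → ℕ, Integrable (fun ω => ∏ i, ω i ^ β i) (κ a) :=
    fun a ha β => hκA a ha ▸ hintβ a ha β
  have hmomκ : ∀ a ∈ A, ∀ β : Fin p → ℕ,
      ∫ ω, (∏ i, ω i ^ β i) ∂(κ a) = MvPolynomial.eval a (pβ β) :=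
    fun a ha β => hκA a ha ▸ hpβ a ha β
  have hp0 : ∀ᵐ q ∂ψ, MvPolynomial.eval q.2 (pβ 0) = 1 := hψA.mono fun q hq => by
    rw [← hmomκ _ hq]
    simp
  have hpint (β : Fin p → ℕ) : Integrable (fun q => MvPolynomial.eval q.2 (pβ β)) ψ := by
    simpa using hψint 0 β
  have hωint (β : Fin p → ℕ) :
      Integrable (fun q : (Fin n → ℝ) × (Fin p → ℝ) => ∏ i, q.2 i ^ β i) ν := by
    simpa using hνint 0 β
  obtain ⟨K, hK, hνK, hψK⟩ := exists_isCompact_ae_mem_of_moments_eq (m₁ := ν) (m₂ := ψ)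
    (π₁ := Prod.fst) (π₂ := Prod.fst) hX hψX (fun α => by simpa using hνint α 0) fun α => by
      have h := hmoments α 0
      rw [integral_congr_ae (hp0.mono fun q hq => congrArg _ hq)] at h
      simpa using h
  have hset {B : Set (Fin n → ℝ)} (hB : MeasurableSet B) (β : Fin p → ℕ) :
      ∫ q in Prod.fst ⁻¹' B, (∏ i, q.2 i ^ β i) ∂ν =
        ∫ q in Prod.fst ⁻¹' B, MvPolynomial.eval q.2 (pβ β) ∂ψ :=
    setIntegral_preimage_eq_of_moments_eq hK measurable_fst hνK measurable_fst hψK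
      (hωint β) (hpint β) (fun α => hmoments α β) hB
  have hmarg {B : Set (Fin n → ℝ)} (hB : MeasurableSet B) :
      ν (Prod.fst ⁻¹' B) = ψ (Prod.fst ⁻¹' B) := by
    have h := hset hB 0
    rw [integral_congr_ae (ae_restrict_of_ae hp0)] at h
    simpa [measureReal_def, ENNReal.toReal_eq_toReal_iff'] using h
  set ρ : Measure ((Fin n → ℝ) × (Fin p → ℝ)) :=
    (ψ ⊗ₘ κ.comap Prod.snd measurable_snd).map fun z => (z.1.1, z.2) with hρ
  have hρ_apply {s : Set ((Fin n → ℝ) × (Fin p → ℝ))} (hs : MeasurableSet s) :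
      ρ s = ∫⁻ q, κ q.2 {ω | (q.1, ω) ∈ s} ∂ψ := by
    have hm : Measurable fun z : ((Fin n → ℝ) × (Fin t → ℝ)) × (Fin p → ℝ) => (z.1.1, z.2) := by
      fun_prop
    rw [hρ, Measure.map_apply hm hs, Measure.compProd_apply (hm hs)]
    rfl
  suffices hνρ : ν = ρ by
    intro s hs
    rw [hνρ, hρ_apply hs]
    exact lintegral_congr_ae (hψA.mono fun q hq => by simp only [hκA _ hq])
  refine Measure.ext_prod fun {B D} hB hD => ?_
  have hBm : MeasurableSet (Prod.fst ⁻¹' B : Set ((Fin n → ℝ) × (Fin t → ℝ))) :=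
    measurable_fst hB
  have hBm' : MeasurableSet (Prod.fst ⁻¹' B : Set ((Fin n → ℝ) × (Fin p → ℝ))) :=
    measurable_fst hB
  have hρBD : ρ (B ×ˢ D) = ∫⁻ q in Prod.fst ⁻¹' B, κ q.2 D ∂ψ := by
    rw [hρ_apply (hB.prod hD), ← lintegral_indicator hBm]
    congr with q
    by_cases hq : q.1 ∈ B <;> simp [hq]
  rw [hρBD]
  by_cases hB0 : ψ (Prod.fst ⁻¹' B) = 0
  · rw [Measure.restrict_zero_set hB0, lintegral_zero_measure]
    exact measure_mono_null (fun q hq => hq.1) ((hmarg hB).trans hB0)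
  have hB0' : ν (Prod.fst ⁻¹' B) ≠ 0 := hmarg hB ▸ hB0
  have := cond_isProbabilityMeasure hB0
  have := cond_isProbabilityMeasure hB0'
  set φ : Measure (Fin t → ℝ) := (ψ[|Prod.fst ⁻¹' B]).map Prod.snd with hφdef
  have hφprob : IsProbabilityMeasure φ :=
    Measure.isProbabilityMeasure_map measurable_snd.aemeasurable
  have hφA : ∀ᵐ a ∂φ, a ∈ A := by
    rw [hφdef, ae_map_iff (p := fun a => a ∈ A) measurable_snd.aemeasurable hAm]
    exact cond_absolutelyContinuous.ae_le hψA
  have hφint (β : Fin p → ℕ) : Integrable (fun a => MvPolynomial.eval a (pβ β)) φ := by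
    rw [hφdef, integrable_map_measure
      (MvPolynomial.continuous_eval _).aestronglyMeasurable measurable_snd.aemeasurable]
    exact (hpint β).restrict.smul_measure (ENNReal.inv_ne_top.mpr hB0)
  have hmonc (β : Fin p → ℕ) : Continuous fun ω : Fin p → ℝ => ∏ i, ω i ^ β i := by fun_prop
  have hμ : (ν[|Prod.fst ⁻¹' B]).map Prod.snd = κ ∘ₘ φ := by
    refine hdet _ ⟨φ, hφprob, hφA, fun D hD => ?_⟩ _
      (Measure.isFiniteMeasure_map _ _) (fun β => ?_) fun β => ?_
    · rw [Measure.bind_apply hD κ.aemeasurable]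
      exact lintegral_congr_ae (hφA.mono fun a ha => by simp only [hκA _ ha])
    · rw [integrable_map_measure (hmonc β).aestronglyMeasurable measurable_snd.aemeasurable]
      exact (hωint β).restrict.smul_measure (ENNReal.inv_ne_top.mpr hB0')
    · rw [integral_monomial_comp hφA hintκ hmomκ hφint,
        integral_map_snd_cond B (hmonc β).stronglyMeasurable, hφdef,
        integral_map_snd_cond B (MvPolynomial.continuous_eval _).stronglyMeasurable,
        hset hB, hmarg hB]
  have hD' := DFunLike.congr_fun hμ D
  rw [Measure.map_apply measurable_snd hD, cond_apply hBm', Measure.bind_apply hD κ.aemeasurable,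
    hφdef, lintegral_map (κ.measurable_coe hD) measurable_snd, ProbabilityTheory.cond,
    lintegral_smul_measure, smul_eq_mul, hmarg hB] at hD'
  exact (ENNReal.mul_right_inj (ENNReal.inv_ne_zero.mpr (measure_ne_top _ _))
    (ENNReal.inv_ne_top.mpr hB0)).mp hD'
end
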